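/- Let p be a positive integer. Every digraph with minimum dicut size τ whose underlying undirected graph is 6p-edge-connected contains ⌊τp/(2p+1)⌋ pairwise arc-disjoint dijoins. -/

import Mathlib

open Finset

variable {V A : Type*} [Fintype V] [DecidableEq V] [Fintype A] [DecidableEq A]

/-- The arcs leaving the vertex set `U`. -/
def outArcs (src tgt : A → V) (U : Finset V) : Finset A :=
  univ.filter fun a => src a ∈ U ∧ tgt a ∉ U

/-- The arcs entering the vertex set `U`. -/
def inArcs (src tgt : A → V) (U : Finset V) : Finset A :=
  univ.filter fun a => tgt a ∈ U ∧ src a ∉ U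

/-- `U` induces a dicut: nonempty, proper, no entering arcs (the dicut is `outArcs U`). -/
def IsDicut (src tgt : A → V) (U : Finset V) : Prop :=
  U.Nonempty ∧ U ≠ univ ∧ inArcs src tgt U = ∅

/-- A dijoin: an arc set meeting every dicut. -/
def IsDijoin (src tgt : A → V) (J : Finset A) : Prop :=
  ∀ U : Finset V, IsDicut src tgt U → (outArcs src tgt U ∩ J).Nonempty

/-- The edges of the underlying undirected graph crossing the cut induced by `U`. -/
def cutEdges (src tgt : A → V) (U : Finset V) : Finset A :=
  outArcs src tgt U ∪ inArcs src tgt U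

section

set_option linter.unusedSectionVars false
variable {W E : Type*} [DecidableEq W] [DecidableEq E]

/-- The number of arcs of `F` leaving `B`, as an integer. -/
def outDeg (s t : E → W) (F : Finset E) (B : Finset W) : ℤ :=
  ∑ e ∈ F, if s e ∈ B ∧ t e ∉ B then 1 else 0

/-- The net number of arcs of `Y` leaving the vertex `x`. -/
def netOut (s t : E → W) (Y : Finset E) (x : W) : ℤ :=
  ∑ e ∈ Y, ((if s e = x then 1 else 0) - if t e = x then 1 else 0)

theorem sum_netOut (s t : E → W) (Y : Finset E) (B : Finset W) :
    ∑ x ∈ B, netOut s t Y x =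
      ∑ e ∈ Y, ((if s e ∈ B then 1 else 0) - if t e ∈ B then (1 : ℤ) else 0) := by
  unfold netOut
  rw [Finset.sum_comm]
  simp [Finset.sum_sub_distrib]

theorem sum_netOut_eq_outDeg_sub (s t : E → W) (Y : Finset E) (B : Finset W) :
    ∑ x ∈ B, netOut s t Y x = outDeg s t Y B - outDeg t s Y B := by
  rw [sum_netOut, outDeg, outDeg, ← Finset.sum_sub_distrib]
  refine Finset.sum_congr rfl fun e _ => ?_
  by_cases h1 : s e ∈ B <;> by_cases h2 : t e ∈ B <;> simp [h1, h2]

theorem outDeg_nonneg (s t : E → W) (F : Finset E) (B : Finset W) : 0 ≤ outDeg s t F B :=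
  Finset.sum_nonneg fun e _ => by split_ifs <;> simp

theorem netOut_swap (s t : E → W) (Y : Finset E) (x : W) : netOut t s Y x = -netOut s t Y x := by
  simp [netOut]

theorem netOut_insert {s t : E → W} {Y : Finset E} {e : E} (he : e ∉ Y) (x : W) :
    netOut s t (insert e Y) x =
      (if s e = x then 1 else 0) - (if t e = x then 1 else 0) + netOut s t Y x :=
  Finset.sum_insert he

theorem netOut_erase {s t : E → W} {Y : Finset E} {e : E} (he : e ∈ Y) (x : W) :
    netOut s t (Y.erase e) x =
      netOut s t Y x - ((if s e = x then 1 else 0) - (if t e = x then 1 else 0)) := by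
  rw [eq_sub_iff_add_eq]; exact Finset.sum_erase_add _ _ he

theorem netOut_congr {s t s' t' : E → W} {Y : Finset E} (hs : ∀ e ∈ Y, s e = s' e)
    (ht : ∀ e ∈ Y, t e = t' e) (x : W) : netOut s t Y x = netOut s' t' Y x :=
  Finset.sum_congr rfl fun e he => by rw [hs e he, ht e he]

/-- The data of a mod `k` flow problem on the digraph with vertex set `S` and arc set `F`: demands
`c`, together with `a` entering and `g` leaving half-arcs at every vertex. The half-arcs only
count towards cut sizes. -/
structure FlowProblem (W E : Type*) where
  S : Finset W
  F : Finset E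
  s : E → W
  t : E → W
  c : W → ℤ
  a : W → ℤ
  g : W → ℤ

namespace FlowProblem

/-- The number of arcs and half-arcs entering `B`. -/
def inCap (P : FlowProblem W E) (B : Finset W) : ℤ := outDeg P.t P.s P.F B + ∑ x ∈ B, P.a x

/-- The number of arcs and half-arcs leaving `B`. -/
def outCap (P : FlowProblem W E) (B : Finset W) : ℤ := outDeg P.s P.t P.F B + ∑ x ∈ B, P.g x

/-- Some integer congruent to the demand of `B` keeps a distance of at least `k - 1 + i` from the
least and `k - 1 + j` from the greatest possible net outflow of `B`. -/
def Room (P : FlowProblem W E) (k i j : ℤ) (B : Finset W) : Prop :=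
  ∃ n, k ∣ n - ∑ x ∈ B, P.c x ∧ k - 1 + i - P.inCap B ≤ n ∧ n ≤ P.outCap B - (k - 1) - j

/-- Some set of arcs has net outflow congruent to `c` modulo `k`. -/
def Solvable (P : FlowProblem W E) (k : ℤ) : Prop :=
  ∃ Y ⊆ P.F, ∀ x ∈ P.S, k ∣ netOut P.s P.t Y x - P.c x

/-- The induction hypothesis for solving mod `k` flow problems, where the vertices in `Z` are
exempt from the cut condition but balanced instead. -/
structure Admissible (P : FlowProblem W E) (k : ℤ) (Z : Finset W) : Prop where
  s_mem : ∀ e ∈ P.F, P.s e ∈ P.S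
  t_mem : ∀ e ∈ P.F, P.t e ∈ P.S
  sum_c : k ∣ ∑ x ∈ P.S, P.c x
  a_nonneg : ∀ x ∈ P.S, 0 ≤ P.a x
  g_nonneg : ∀ x ∈ P.S, 0 ≤ P.g x
  halfArcs : (∑ x ∈ P.S, P.a x + 1 ≤ 2 * k ∧ ∑ x ∈ P.S, P.g x + 1 ≤ k) ∨
    (∑ x ∈ P.S, P.a x + 1 ≤ k ∧ ∑ x ∈ P.S, P.g x + 1 ≤ 2 * k)
  subset : Z ⊆ P.S
  card_le : Z.card ≤ 1
  balanced : ∀ x ∈ Z, ∃ h, P.inCap {x} + P.outCap {x} = 2 * h ∧ k ∣ P.c x - (P.outCap {x} - h)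
  room : ∀ B ⊆ P.S, B.Nonempty → B ≠ P.S → B ≠ Z → P.Room k 0 0 B

/-- The order on problems used for the induction. -/
def Smaller (Q P : FlowProblem W E) : Prop :=
  Q.S.card < P.S.card ∨ Q.S.card = P.S.card ∧ Q.F.card < P.F.card

/-- A minimal counterexample. -/
structure Critical (P : FlowProblem W E) (k : ℤ) (Z : Finset W) : Prop
    extends P.Admissible k Z where
  not_solvable : ¬ P.Solvable k
  minimal : ∀ (Q : FlowProblem W E) (Z' : Finset W), Q.Smaller P → Q.Admissible k Z' → Q.Solvable k

theorem Room.transfer {P Q : FlowProblem W E} {k i j i' j' : ℤ} {B B' : Finset W}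
    (h : P.Room k i j B) (d : ℤ) (hc : k ∣ ∑ x ∈ B, P.c x - ∑ x ∈ B', Q.c x - d)
    (hin : P.inCap B + i' + d ≤ Q.inCap B' + i) (hout : P.outCap B + j' - d ≤ Q.outCap B' + j) :
    Q.Room k i' j' B' := by
  obtain ⟨n, h1, h2, h3⟩ := h
  refine ⟨n - d, ?_, by linarith, by linarith⟩
  rw [show n - d - ∑ x ∈ B', Q.c x =
    n - ∑ x ∈ B, P.c x + (∑ x ∈ B, P.c x - ∑ x ∈ B', Q.c x - d) by ring]
  exact dvd_add h1 hc

theorem Room.mono {P : FlowProblem W E} {k i j i' j' : ℤ} {B : Finset W}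
    (h : P.Room k i j B) (hi : i' ≤ i) (hj : j' ≤ j) : P.Room k i' j' B :=
  h.transfer 0 (by simp) (by linarith) (by linarith)

/-! ### Reversal -/

/-- All arcs and half-arcs reversed. -/
def rev (P : FlowProblem W E) : FlowProblem W E :=
  { P with s := P.t, t := P.s, c := fun x => -P.c x, a := P.g, g := P.a }

theorem Room.rev {P : FlowProblem W E} {k i j : ℤ} {B : Finset W} (h : P.Room k i j B) :
    P.rev.Room k j i B := by
  obtain ⟨n, h1, h2, h3⟩ := h
  refine ⟨-n, ?_, ?_, ?_⟩
  · have : -n - ∑ x ∈ B, P.rev.c x = -(n - ∑ x ∈ B, P.c x) := by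
      simp only [FlowProblem.rev, Finset.sum_neg_distrib]; ring
    rw [this]
    exact h1.neg_right
  · change k - 1 + j - P.outCap B ≤ -n
    linarith
  · change -n ≤ P.inCap B - (k - 1) - i
    linarith

theorem Solvable.of_rev {P : FlowProblem W E} {k : ℤ} (h : P.rev.Solvable k) : P.Solvable k := by
  obtain ⟨Y, hY, h⟩ := h
  refine ⟨Y, hY, fun x hx => ?_⟩
  have h1 := (h x hx).neg_right
  have h2 : netOut P.rev.s P.rev.t Y x = - netOut P.s P.t Y x := netOut_swap _ _ _ _
  rw [h2] at h1
  rwa [show -(-netOut P.s P.t Y x - P.rev.c x) = netOut P.s P.t Y x - P.c x by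
    change -(-netOut P.s P.t Y x - -P.c x) = _; ring] at h1

theorem Critical.rev {P : FlowProblem W E} {k : ℤ} {Z : Finset W} (h : P.Critical k Z) :
    P.rev.Critical k Z where
  s_mem := h.t_mem
  t_mem := h.s_mem
  sum_c := by simpa [FlowProblem.rev] using h.sum_c
  a_nonneg := h.g_nonneg
  g_nonneg := h.a_nonneg
  halfArcs := h.halfArcs.symm.imp And.symm And.symm
  subset := h.subset
  card_le := h.card_le
  balanced x hx := by
    obtain ⟨m, h1, h2⟩ := h.balanced x hx
    refine ⟨m, ?_, ?_⟩
    · change P.outCap {x} + P.inCap {x} = _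
      linarith
    · change k ∣ -P.c x - (P.inCap {x} - m)
      have h3 := h2.neg_right
      rwa [show -(P.c x - (P.outCap {x} - m)) = -P.c x - (P.inCap {x} - m) by linarith] at h3
  room B h1 h2 h3 h4 := (h.room B h1 h2 h3 h4).rev
  not_solvable hs := h.not_solvable hs.of_rev
  minimal := h.minimal

/-! ### Flipping an arc -/

/-- The arc `e` reversed, with the demands adjusted. -/
def flip (P : FlowProblem W E) (e : E) : FlowProblem W E :=
  { P with
    s := Function.update P.s e (P.t e)
    t := Function.update P.t e (P.s e)
    c := fun x => P.c x - (if P.s e = x then 1 else 0) + if P.t e = x then 1 else 0 }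

theorem sum_eq_sum_add_of_eq_off {F : Finset E} {f f' : E → ℤ} {e : E} (he : e ∈ F)
    (h : ∀ d ∈ F, d ≠ e → f' d = f d) : ∑ d ∈ F, f' d = ∑ d ∈ F, f d + (f' e - f e) := by
  rw [← Finset.add_sum_erase F f he, ← Finset.add_sum_erase F f' he,
    Finset.sum_congr rfl fun d hd => h d (Finset.mem_of_mem_erase hd) (Finset.ne_of_mem_erase hd)]
  ring

theorem sum_c_flip (P : FlowProblem W E) (e : E) (B : Finset W) :
    ∑ x ∈ B, (P.flip e).c x =
      ∑ x ∈ B, P.c x - (if P.s e ∈ B then 1 else 0) + if P.t e ∈ B then 1 else 0 := by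
  simp [flip, Finset.sum_add_distrib, Finset.sum_sub_distrib]

theorem inCap_flip (P : FlowProblem W E) {e : E} (he : e ∈ P.F) (B : Finset W) :
    (P.flip e).inCap B =
      P.inCap B + (if P.s e ∈ B then 1 else 0) - if P.t e ∈ B then 1 else 0 := by
  have := sum_eq_sum_add_of_eq_off he
    (f := fun d => if P.t d ∈ B ∧ P.s d ∉ B then 1 else 0)
    (f' := fun d => if (P.flip e).t d ∈ B ∧ (P.flip e).s d ∉ B then 1 else 0)
    (fun d _ hd => by simp [flip, hd])
  simp only [inCap, outDeg]
  change _ + ∑ x ∈ B, P.a x = _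
  rw [show (P.flip e).F = P.F from rfl, this]
  by_cases h1 : P.s e ∈ B <;> by_cases h2 : P.t e ∈ B <;> simp [flip, h1, h2] <;> ring

theorem outCap_flip (P : FlowProblem W E) {e : E} (he : e ∈ P.F) (B : Finset W) :
    (P.flip e).outCap B =
      P.outCap B - (if P.s e ∈ B then 1 else 0) + if P.t e ∈ B then 1 else 0 := by
  have := sum_eq_sum_add_of_eq_off he
    (f := fun d => if P.s d ∈ B ∧ P.t d ∉ B then 1 else 0)
    (f' := fun d => if (P.flip e).s d ∈ B ∧ (P.flip e).t d ∉ B then 1 else 0)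
    (fun d _ hd => by simp [flip, hd])
  simp only [outCap, outDeg]
  change _ + ∑ x ∈ B, P.g x = _
  rw [show (P.flip e).F = P.F from rfl, this]
  by_cases h1 : P.s e ∈ B <;> by_cases h2 : P.t e ∈ B <;> simp [flip, h1, h2] <;> ring

theorem Room.flip {P : FlowProblem W E} {k i j : ℤ} {B : Finset W} (h : P.Room k i j B)
    {e : E} (he : e ∈ P.F) : (P.flip e).Room k i j B :=
  h.transfer ((if P.s e ∈ B then 1 else 0) - if P.t e ∈ B then 1 else 0)
    (by rw [sum_c_flip]; ring_nf; simp) (by rw [inCap_flip P he]; linarith)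
    (by rw [outCap_flip P he]; linarith)

theorem Solvable.of_flip {P : FlowProblem W E} {k : ℤ} {e : E} (he : e ∈ P.F)
    (h : (P.flip e).Solvable k) : P.Solvable k := by
  obtain ⟨Y, hY, h⟩ := h
  have key : ∀ Y' : Finset E, e ∉ Y' → ∀ x,
      netOut (P.flip e).s (P.flip e).t Y' x = netOut P.s P.t Y' x := fun Y' h' x =>
    netOut_congr (fun d hd => by simp [FlowProblem.flip, ne_of_mem_of_not_mem hd h'])
      (fun d hd => by simp [FlowProblem.flip, ne_of_mem_of_not_mem hd h']) x
  by_cases heY : e ∈ Y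
  · refine ⟨Y.erase e, (Finset.erase_subset _ _).trans hY, fun x hx => ?_⟩
    have h1 := h x hx
    rw [← key _ (by simp), netOut_erase heY]
    convert h1 using 1
    simp [FlowProblem.flip]
    ring
  · refine ⟨insert e Y, Finset.insert_subset he hY, fun x hx => ?_⟩
    have h1 := h x hx
    rw [netOut_insert heY, ← key _ heY]
    convert h1 using 1
    simp [FlowProblem.flip]
    ring

theorem Critical.flip {P : FlowProblem W E} {k : ℤ} {Z : Finset W} (h : P.Critical k Z)
    {e : E} (he : e ∈ P.F) : (P.flip e).Critical k Z where
  s_mem d hd := by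
    by_cases hde : d = e
    · simpa [FlowProblem.flip, hde] using h.t_mem e he
    · simpa [FlowProblem.flip, hde] using h.s_mem d hd
  t_mem d hd := by
    by_cases hde : d = e
    · simpa [FlowProblem.flip, hde] using h.s_mem e he
    · simpa [FlowProblem.flip, hde] using h.t_mem d hd
  sum_c := by
    rw [sum_c_flip]
    simpa [FlowProblem.flip, h.s_mem e he, h.t_mem e he] using h.sum_c
  a_nonneg := h.a_nonneg
  g_nonneg := h.g_nonneg
  halfArcs := h.halfArcs
  subset := h.subset
  card_le := h.card_le
  balanced x hx := by
    obtain ⟨m, h1, h2⟩ := h.balanced x hx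
    have hc := sum_c_flip P e {x}
    rw [Finset.sum_singleton, Finset.sum_singleton] at hc
    rw [inCap_flip P he, outCap_flip P he, hc]
    refine ⟨m, by linarith, ?_⟩
    convert h2 using 1
    ring
  room B h1 h2 h3 h4 := (h.room B h1 h2 h3 h4).flip he
  not_solvable hs := h.not_solvable (hs.of_flip he)
  minimal := h.minimal

/-! ### Identifying vertices -/

/-- The problem obtained by identifying vertices along `π`. -/
def map (P : FlowProblem W E) (π : W → W) : FlowProblem W E where
  S := P.S.image π
  F := P.F
  s := π ∘ P.s
  t := π ∘ P.t
  c v := ∑ u ∈ P.S with π u = v, P.c u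
  a v := ∑ u ∈ P.S with π u = v, P.a u
  g v := ∑ u ∈ P.S with π u = v, P.g u

theorem sum_sum_fiber (S B : Finset W) (π : W → W) (f : W → ℤ) :
    ∑ v ∈ B, ∑ u ∈ S with π u = v, f u = ∑ u ∈ S with π u ∈ B, f u := by
  simp_rw [Finset.sum_filter]
  rw [Finset.sum_comm]
  simp

theorem outDeg_comp {s t : E → W} {F : Finset E} {S : Finset W} (hs : ∀ e ∈ F, s e ∈ S)
    (ht : ∀ e ∈ F, t e ∈ S) (π : W → W) (B : Finset W) :
    outDeg (π ∘ s) (π ∘ t) F B = outDeg s t F {u ∈ S | π u ∈ B} :=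
  Finset.sum_congr rfl fun e he => by simp [hs e he, ht e he]

theorem netOut_comp {s t : E → W} {F Y : Finset E} {S : Finset W} (hs : ∀ e ∈ F, s e ∈ S)
    (ht : ∀ e ∈ F, t e ∈ S) (hY : Y ⊆ F) (π : W → W) (v : W) :
    netOut (π ∘ s) (π ∘ t) Y v = ∑ u ∈ S with π u = v, netOut s t Y u := by
  rw [sum_netOut]
  exact Finset.sum_congr rfl fun e he => by simp [hs e (hY he), ht e (hY he)]

theorem Critical.exists_collapse {P : FlowProblem W E} {k : ℤ} {Z B : Finset W}
    (h : P.Critical k Z) (hB : B ⊆ P.S) (hcard : 2 ≤ B.card) :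
    ∃ Y ⊆ P.F, (∀ x ∈ P.S, x ∉ B → k ∣ netOut P.s P.t Y x - P.c x) ∧
      k ∣ ∑ x ∈ B, netOut P.s P.t Y x - ∑ x ∈ B, P.c x := by
  obtain ⟨b, hb, b', hb', hne⟩ := Finset.one_lt_card.1 hcard
  set π : W → W := fun v => if v ∈ B then b else v with hπ
  have hin : ∀ D, (P.map π).inCap D = P.inCap {u ∈ P.S | π u ∈ D} := fun D => by
    simp only [inCap, map, sum_sum_fiber, outDeg_comp h.t_mem h.s_mem]
  have hout : ∀ D, (P.map π).outCap D = P.outCap {u ∈ P.S | π u ∈ D} := fun D => by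
    simp only [outCap, map, sum_sum_fiber, outDeg_comp h.s_mem h.t_mem]
  have hc : ∀ D, ∑ x ∈ D, (P.map π).c x = ∑ u ∈ P.S with π u ∈ D, P.c u := fun D => by
    simp only [map, sum_sum_fiber]
  have hfix : ∀ v ∈ P.S, v ∉ B → {u ∈ P.S | π u = v} = {v} := fun v hv hvB => by
    ext u; simp only [hπ, Finset.mem_filter, Finset.mem_singleton]
    constructor
    · rintro ⟨h1, h2⟩
      split_ifs at h2 with h3
      · exact absurd (h2 ▸ hb) hvB
      · exact h2
    · rintro rfl; simp [hv, hvB]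
  have hfib : {u ∈ P.S | π u = b} = B := by
    ext u; simp only [hπ, Finset.mem_filter]
    constructor
    · rintro ⟨h1, h2⟩
      split_ifs at h2 with h3
      · exact h3
      · exact h2 ▸ hb
    · intro hu; simp [hB hu, hu]
  have hfull : {u ∈ P.S | π u ∈ P.S.image π} = P.S :=
    Finset.filter_true_of_mem fun u hu => Finset.mem_image_of_mem π hu
  have hpre : ∀ D, {u ∈ P.S | π u ∈ D} = P.S → P.S.image π ⊆ D := fun D hD => by
    intro v hv
    obtain ⟨u, hu, rfl⟩ := Finset.mem_image.1 hv
    rw [← hD] at hu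
    exact (Finset.mem_filter.1 hu).2
  have hsmaller : (P.map π).Smaller P := by
    left
    refine lt_of_le_of_ne Finset.card_image_le fun h' => hne ?_
    exact Finset.card_image_iff.1 h' (hB hb) (hB hb') (by simp [hπ, hb'])
  have hadm : (P.map π).Admissible k (Z \ B) :=
    { s_mem := fun e he => Finset.mem_image_of_mem π (h.s_mem e he)
      t_mem := fun e he => Finset.mem_image_of_mem π (h.t_mem e he)
      sum_c := by
        rw [hc, show (P.map π).S = P.S.image π from rfl, hfull]
        exact h.sum_c
      a_nonneg := fun x _ => Finset.sum_nonneg fun u hu => h.a_nonneg u (Finset.mem_filter.1 hu).1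
      g_nonneg := fun x _ => Finset.sum_nonneg fun u hu => h.g_nonneg u (Finset.mem_filter.1 hu).1
      halfArcs := by
        have := h.halfArcs
        simp only [map, sum_sum_fiber, hfull]
        exact this
      subset := fun x hx => by
        obtain ⟨h1, h2⟩ := Finset.mem_sdiff.1 hx
        exact Finset.mem_image.2 ⟨x, h.subset h1, by simp [hπ, h2]⟩
      card_le := (Finset.card_le_card Finset.sdiff_subset).trans h.card_le
      balanced := fun x hx => by
        obtain ⟨h1, h2⟩ := Finset.mem_sdiff.1 hx
        have h3 : {u ∈ P.S | π u ∈ ({x} : Finset W)} = {x} := by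
          simpa using hfix x (h.subset h1) h2
        have h4 := hc {x}
        rw [Finset.sum_singleton, h3, Finset.sum_singleton] at h4
        rw [hin, hout, h3, h4]
        exact h.balanced x h1
      room := fun D hD hD1 hD2 hD3 => by
        have hroom : P.Room k 0 0 {u ∈ P.S | π u ∈ D} := by
          refine h.room _ (Finset.filter_subset _ _) ?_ ?_ ?_
          · obtain ⟨v, hv⟩ := hD1
            obtain ⟨u, hu, rfl⟩ := Finset.mem_image.1 (hD hv)
            exact ⟨u, by simp [hu, hv]⟩
          · exact fun h' => hD2 (Finset.Subset.antisymm hD (hpre D h'))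
          · rintro rfl
            have hbD : b ∉ D := by
              intro hbD
              have : B ⊆ {u ∈ P.S | π u ∈ D} := fun u hu => by simp [hB hu, hπ, hu, hbD]
              have := Finset.card_le_card this
              have := h.card_le
              omega
            apply hD3
            ext x
            simp only [Finset.mem_sdiff, Finset.mem_filter]
            constructor
            · intro hx
              obtain ⟨u, hu, rfl⟩ := Finset.mem_image.1 (hD hx)
              have huB : u ∉ B := fun huB => hbD (by simpa [hπ, huB] using hx)
              simp only [hπ, huB, if_false] at hx ⊢
              simp [hu, hx]
            · rintro ⟨⟨_, h2⟩, h3⟩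
              simpa [hπ, h3] using h2
        exact hroom.transfer 0 (by rw [hc]; simp) (by rw [hin]; linarith) (by rw [hout]; linarith) }
  obtain ⟨Y, hY, hsol⟩ := h.minimal _ _ hsmaller hadm
  refine ⟨Y, hY, fun x hx hxB => ?_, ?_⟩
  · have h1 := hsol x (Finset.mem_image.2 ⟨x, hx, by simp [hπ, hxB]⟩)
    rw [show netOut (P.map π).s (P.map π).t Y x = _ from netOut_comp h.s_mem h.t_mem hY π x] at h1
    simpa only [map, hfix x hx hxB, Finset.sum_singleton] using h1
  · have h1 := hsol b (Finset.mem_image.2 ⟨b, hB hb, by simp [hπ]⟩)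
    rw [show netOut (P.map π).s (P.map π).t Y b = _ from netOut_comp h.s_mem h.t_mem hY π b] at h1
    simpa only [map, hfib] using h1

/-! ### Slack of the cut condition -/

/-- The problem left on `B` once the arcs of `Y` not inside `B` are fixed. -/
def inside (P : FlowProblem W E) (B : Finset W) (Y : Finset E) : FlowProblem W E where
  S := B
  F := {e ∈ P.F | P.s e ∈ B ∧ P.t e ∈ B}
  s := P.s
  t := P.t
  c x := P.c x - netOut P.s P.t {e ∈ Y | ¬ (P.s e ∈ B ∧ P.t e ∈ B)} x
  a x := P.a x + ∑ e ∈ P.F, ((if P.t e = x then if P.s e ∉ B ∧ e ∉ Y then 1 else 0 else 0) +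
    if P.s e = x then if P.t e ∉ B ∧ e ∈ Y then 1 else 0 else 0)
  g x := P.g x + ∑ e ∈ P.F, ((if P.s e = x then if P.t e ∉ B ∧ e ∉ Y then 1 else 0 else 0) +
    if P.t e = x then if P.s e ∉ B ∧ e ∈ Y then 1 else 0 else 0)

theorem sum_netOut_subset {s t : E → W} {F Y : Finset E} (hY : Y ⊆ F) (p : E → Prop)
    [DecidablePred p] (D : Finset W) :
    ∑ x ∈ D, netOut s t {e ∈ Y | p e} x = ∑ e ∈ F, if p e ∧ e ∈ Y then
      ((if s e ∈ D then 1 else 0) - if t e ∈ D then (1 : ℤ) else 0) else 0 := by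
  rw [sum_netOut, ← Finset.sum_filter]
  refine Finset.sum_congr ?_ fun _ _ => rfl
  ext e
  simp only [Finset.mem_filter]
  exact ⟨fun h => ⟨hY h.1, h.2, h.1⟩, fun h => ⟨h.2.2, h.2.1⟩⟩

theorem inCap_inside (P : FlowProblem W E) {B D : Finset W} {Y : Finset E} (hY : Y ⊆ P.F)
    (hD : D ⊆ B) : (P.inside B Y).inCap D =
      P.inCap D + ∑ x ∈ D, netOut P.s P.t {e ∈ Y | ¬ (P.s e ∈ B ∧ P.t e ∈ B)} x := by
  rw [sum_netOut_subset hY]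
  simp only [inCap, outDeg, inside, Finset.sum_add_distrib, Finset.sum_filter]
  rw [Finset.sum_comm (s := D), Finset.sum_comm (s := D)]
  simp only [Finset.sum_ite_eq]
  have : ∀ x y z u v w : ℤ, x + z + u = v + w → x + (y + (z + u)) = v + y + w := by
    intros; linarith
  apply this
  simp only [← Finset.sum_add_distrib]
  refine Finset.sum_congr rfl fun e _ => ?_
  have h1 := @hD (P.s e)
  have h2 := @hD (P.t e)
  by_cases s1 : P.s e ∈ D <;> by_cases t1 : P.t e ∈ D <;> by_cases s2 : P.s e ∈ B <;>
    by_cases t2 : P.t e ∈ B <;> by_cases hy : e ∈ Y <;> simp_all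

theorem outCap_inside (P : FlowProblem W E) {B D : Finset W} {Y : Finset E} (hY : Y ⊆ P.F)
    (hD : D ⊆ B) : (P.inside B Y).outCap D =
      P.outCap D - ∑ x ∈ D, netOut P.s P.t {e ∈ Y | ¬ (P.s e ∈ B ∧ P.t e ∈ B)} x := by
  rw [sum_netOut_subset hY]
  simp only [outCap, outDeg, inside, Finset.sum_add_distrib, Finset.sum_filter]
  rw [Finset.sum_comm (s := D), Finset.sum_comm (s := D)]
  simp only [Finset.sum_ite_eq]
  have : ∀ x y z u v w : ℤ, x + z + u = v - w → x + (y + (z + u)) = v + y - w := by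
    intros; linarith
  apply this
  simp only [← Finset.sum_add_distrib, ← Finset.sum_sub_distrib]
  refine Finset.sum_congr rfl fun e _ => ?_
  have h1 := @hD (P.s e)
  have h2 := @hD (P.t e)
  by_cases s1 : P.s e ∈ D <;> by_cases t1 : P.t e ∈ D <;> by_cases s2 : P.s e ∈ B <;>
    by_cases t2 : P.t e ∈ B <;> by_cases hy : e ∈ Y <;> simp_all

theorem eq_or_eq_of_dvd_add_one {k a : ℤ} (hk : 0 < k) (h : k ∣ a + 1) (h0 : 0 ≤ a)
    (ha : a ≤ 3 * k - 2) : a = k - 1 ∨ a = 2 * k - 1 := by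
  obtain ⟨m, hm⟩ := h
  have h1 : 0 < m := by by_contra hc; nlinarith
  have h2 : m < 3 := by by_contra hc; nlinarith
  interval_cases m
  · left; linarith
  · right; linarith

theorem Critical.room_one_one {P : FlowProblem W E} {k : ℤ} {Z B : Finset W}
    (h : P.Critical k Z) (hk : 0 < k) (hB : B ⊆ P.S) (hcard : 2 ≤ B.card) (hne : B ≠ P.S) :
    P.Room k 1 1 B := by
  by_contra hno
  have hZ := h.card_le
  obtain ⟨n, hn1, hn2, hn3⟩ := h.room B hB (Finset.card_pos.1 (by omega)) hne
    (by rintro rfl; omega)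
  have hcap : P.inCap B + P.outCap B ≤ 3 * k - 2 := by
    by_contra hc
    push Not at hc
    by_cases h1 : n ≤ k - 1 - P.inCap B
    · refine hno ⟨n + k, ?_, by linarith, by linarith⟩
      rw [show n + k - ∑ x ∈ B, P.c x = n - ∑ x ∈ B, P.c x + k by ring]
      exact dvd_add_self_right.2 hn1
    · by_cases h2 : P.outCap B - (k - 1) ≤ n
      · refine hno ⟨n - k, ?_, by linarith, by linarith⟩
        rw [show n - k - ∑ x ∈ B, P.c x = n - ∑ x ∈ B, P.c x - k by ring]
        exact dvd_sub_self_right.2 hn1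
      · exact hno ⟨n, hn1, by linarith, by linarith⟩
  have htight : n = k - 1 - P.inCap B ∨ n = P.outCap B - (k - 1) := by
    by_contra! hc
    have h1 := hc.1.symm.lt_of_le (by linarith)
    have h2 := hc.2.lt_of_le (by linarith)
    exact hno ⟨n, hn1, by linarith, by linarith⟩
  obtain ⟨Y, hY, hsol, hsolB⟩ := h.exists_collapse hB hcard
  set Q := P.inside B Y with hQ
  set N : W → ℤ := netOut P.s P.t {e ∈ Y | ¬ (P.s e ∈ B ∧ P.t e ∈ B)} with hN
  have hin : ∀ D ⊆ B, Q.inCap D = P.inCap D + ∑ x ∈ D, N x := fun D hD => P.inCap_inside hY hD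
  have hout : ∀ D ⊆ B, Q.outCap D = P.outCap D - ∑ x ∈ D, N x := fun D hD => P.outCap_inside hY hD
  have hQc : ∀ D, ∑ x ∈ D, Q.c x = ∑ x ∈ D, P.c x - ∑ x ∈ D, N x := fun D => by
    simp [hQ, hN, inside]
  have hsplit : ∀ x, netOut P.s P.t Y x =
      netOut P.s P.t {e ∈ Y | P.s e ∈ B ∧ P.t e ∈ B} x + N x := fun x =>
    (Finset.sum_filter_add_sum_filter_not Y _ _).symm
  have hNB : k ∣ ∑ x ∈ B, N x - ∑ x ∈ B, P.c x := by
    have h0 : ∑ x ∈ B, netOut P.s P.t {e ∈ Y | P.s e ∈ B ∧ P.t e ∈ B} x = 0 := by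
      rw [sum_netOut]
      exact Finset.sum_eq_zero fun e he => by simp [(Finset.mem_filter.1 he).2]
    simpa only [hsplit, Finset.sum_add_distrib, h0, zero_add] using hsolB
  have ha0 : ∀ x ∈ B, 0 ≤ Q.a x := fun x hx => add_nonneg (h.a_nonneg x (hB hx))
    (Finset.sum_nonneg fun e _ => add_nonneg (by split_ifs <;> simp) (by split_ifs <;> simp))
  have hg0 : ∀ x ∈ B, 0 ≤ Q.g x := fun x hx => add_nonneg (h.g_nonneg x (hB hx))
    (Finset.sum_nonneg fun e _ => add_nonneg (by split_ifs <;> simp) (by split_ifs <;> simp))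
  have ha : ∑ x ∈ B, Q.a x = P.inCap B + ∑ x ∈ B, N x := by
    rw [← hin B subset_rfl, inCap, right_eq_add]
    exact Finset.sum_eq_zero fun e he => if_neg fun h' => h'.2 (Finset.mem_filter.1 he).2.1
  have hg : ∑ x ∈ B, Q.g x = P.outCap B - ∑ x ∈ B, N x := by
    rw [← hout B subset_rfl, outCap, right_eq_add]
    exact Finset.sum_eq_zero fun e he => if_neg fun h' => h'.2 (Finset.mem_filter.1 he).2.2
  have ha0' := Finset.sum_nonneg ha0
  have hg0' := Finset.sum_nonneg hg0
  have hsmaller : Q.Smaller P :=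
    Or.inl (Finset.card_lt_card (Finset.ssubset_iff_subset_ne.2 ⟨hB, hne⟩))
  have hadm : Q.Admissible k (Z ∩ B) :=
    { s_mem := fun e he => (Finset.mem_filter.1 he).2.1
      t_mem := fun e he => (Finset.mem_filter.1 he).2.2
      sum_c := by
        rw [hQc, ← neg_sub]
        exact hNB.neg_right
      a_nonneg := ha0
      g_nonneg := hg0
      halfArcs := by
        change (∑ x ∈ B, Q.a x + 1 ≤ 2 * k ∧ ∑ x ∈ B, Q.g x + 1 ≤ k) ∨
          (∑ x ∈ B, Q.a x + 1 ≤ k ∧ ∑ x ∈ B, Q.g x + 1 ≤ 2 * k)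
        rcases htight with ht | ht
        · have hd : k ∣ ∑ x ∈ B, Q.a x + 1 := by
            rw [show ∑ x ∈ B, Q.a x + 1 =
              ∑ x ∈ B, N x - ∑ x ∈ B, P.c x - (n - ∑ x ∈ B, P.c x) + k by linarith]
            exact dvd_add_self_right.2 (dvd_sub hNB hn1)
          rcases eq_or_eq_of_dvd_add_one hk hd ha0' (by linarith) with h1 | h1
          · right; constructor <;> linarith
          · left; constructor <;> linarith
        · have hd : k ∣ ∑ x ∈ B, Q.g x + 1 := by
            rw [show ∑ x ∈ B, Q.g x + 1 =
              n - ∑ x ∈ B, P.c x - (∑ x ∈ B, N x - ∑ x ∈ B, P.c x) + k by linarith]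
            exact dvd_add_self_right.2 (dvd_sub hn1 hNB)
          rcases eq_or_eq_of_dvd_add_one hk hd hg0' (by linarith) with h1 | h1
          · left; constructor <;> linarith
          · right; constructor <;> linarith
      subset := Finset.inter_subset_right
      card_le := (Finset.card_le_card Finset.inter_subset_left).trans hZ
      balanced := fun x hx => by
        obtain ⟨h1, h2⟩ := Finset.mem_inter.1 hx
        obtain ⟨m, h3, h4⟩ := h.balanced x h1
        have h5 : ({x} : Finset W) ⊆ B := by simpa using h2
        have h6 := hQc {x}
        rw [hin _ h5, hout _ h5]
        simp only [Finset.sum_singleton] at h6 ⊢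
        refine ⟨m, by linarith, ?_⟩
        rw [h6]
        convert h4 using 1
        ring
      room := fun D hD hD1 hD2 hD3 => by
        refine (h.room D (hD.trans hB) hD1 ?_ ?_).transfer (∑ x ∈ D, N x) ?_ ?_ ?_
        · rintro rfl
          exact hD2 (Finset.Subset.antisymm hD hB)
        · rintro rfl
          exact hD3 (Finset.inter_eq_left.2 hD).symm
        · rw [hQc]; ring_nf; simp
        · rw [hin D hD]; linarith
        · rw [hout D hD]; linarith }
  obtain ⟨Y', hY', hsol'⟩ := h.minimal _ _ hsmaller hadm
  have hdisj : Disjoint {e ∈ Y | ¬ (P.s e ∈ B ∧ P.t e ∈ B)} Y' :=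
    Finset.disjoint_left.2 fun e h1 h2 =>
      (Finset.mem_filter.1 h1).2 (Finset.mem_filter.1 (hY' h2)).2
  refine h.not_solvable ⟨{e ∈ Y | ¬ (P.s e ∈ B ∧ P.t e ∈ B)} ∪ Y', Finset.union_subset
    ((Finset.filter_subset _ _).trans hY) (hY'.trans (Finset.filter_subset _ _)), fun x hx => ?_⟩
  have hun : netOut P.s P.t ({e ∈ Y | ¬ (P.s e ∈ B ∧ P.t e ∈ B)} ∪ Y') x =
      N x + netOut P.s P.t Y' x := Finset.sum_union hdisj
  by_cases hxB : x ∈ B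
  · rw [hun]
    convert hsol' x hxB using 1
    simp only [hQ, hN, inside]
    ring
  · have hzero : ∀ T : Finset E, (∀ e ∈ T, P.s e ∈ B ∧ P.t e ∈ B) → netOut P.s P.t T x = 0 :=
      fun T hT => Finset.sum_eq_zero fun e he => by
        simp [ne_of_mem_of_not_mem (hT e he).1 hxB, ne_of_mem_of_not_mem (hT e he).2 hxB]
    have h1 := hsplit x
    rw [hzero _ fun e he => (Finset.mem_filter.1 he).2, zero_add] at h1
    rw [hun, hzero _ fun e he => (Finset.mem_filter.1 (hY' he)).2, ← h1, add_zero]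
    exact hsol x hx hxB

theorem two_le_card {B : Finset W} {x : W} (hx : x ∈ B) (h : B ≠ {x}) : 2 ≤ B.card :=
  Finset.one_lt_card_iff_nontrivial.2 ((Finset.nontrivial_iff_ne_singleton hx).2 h)

/-- The arc `e` has ends `x` and `y`, in some order. -/
def Joins (P : FlowProblem W E) (e : E) (x y : W) : Prop :=
  P.s e = x ∧ P.t e = y ∨ P.s e = y ∧ P.t e = x

theorem Critical.orient {P : FlowProblem W E} {k : ℤ} {Z : Finset W} (h : P.Critical k Z) {e : E}
    (he : e ∈ P.F) {x y : W} (hxy : P.Joins e x y) :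
    ∃ Q : FlowProblem W E, Q.Critical k Z ∧ Q.S = P.S ∧ Q.F = P.F ∧ Q.a = P.a ∧ Q.g = P.g ∧
      Q.s e = x ∧ Q.t e = y ∧ (∀ d, d ≠ e → Q.s d = P.s d ∧ Q.t d = P.t d) ∧
      ∀ i j B, P.Room k i j B → Q.Room k i j B := by
  rcases hxy with ⟨hx, hy⟩ | ⟨hx, hy⟩
  · exact ⟨P, h, rfl, rfl, rfl, rfl, hx, hy, fun _ _ => ⟨rfl, rfl⟩, fun _ _ _ h => h⟩
  · exact ⟨P.flip e, h.flip he, rfl, rfl, rfl, rfl, by simp [FlowProblem.flip, hy],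
      by simp [FlowProblem.flip, hx], fun d hd => by simp [FlowProblem.flip, hd],
      fun _ _ _ h => h.flip he⟩

/-! ### Vertices exempt from the cut condition -/

theorem Critical.a_le_zero_of_s_eq {P : FlowProblem W E} {k : ℤ} {x : W} (h : P.Critical k {x})
    (hk : 0 < k) {e : E} (he : e ∈ P.F) (hs : P.s e = x) (ht : P.t e ≠ x) : P.a x ≤ 0 := by
  by_contra! ha
  have hxS : x ∈ P.S := h.subset (by simp)
  obtain ⟨v, hv⟩ : ∃ v, v = P.t e := ⟨_, rfl⟩
  have hvS : v ∈ P.S := hv ▸ h.t_mem e he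
  rw [← hv] at ht
  set Q : FlowProblem W E := { P with
    F := P.F.erase e
    a := fun y => P.a y - (if x = y then 1 else 0) + if v = y then 1 else 0 } with hQ
  have hin : ∀ B, Q.inCap B = P.inCap B - if x ∈ B ∧ v ∉ B then 1 else 0 := fun B => by
    have h1 := Finset.add_sum_erase P.F (fun e => if P.t e ∈ B ∧ P.s e ∉ B then (1 : ℤ) else 0) he
    simp only [inCap, outDeg, hQ, Finset.sum_add_distrib, Finset.sum_sub_distrib,
      Finset.sum_ite_eq]
    rw [← h1]
    simp only [hs, ← hv]
    by_cases h2 : x ∈ B <;> by_cases h3 : v ∈ B <;> simp [h2, h3] <;> ring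
  have hout : ∀ B, Q.outCap B = P.outCap B - if x ∈ B ∧ v ∉ B then 1 else 0 := fun B => by
    have h1 := Finset.add_sum_erase P.F (fun e => if P.s e ∈ B ∧ P.t e ∉ B then (1 : ℤ) else 0) he
    simp only [outCap, outDeg, hQ]
    rw [← h1]
    simp only [hs, ← hv]
    ring
  have hadm : Q.Admissible k {x} :=
    { s_mem := fun e he => h.s_mem e (Finset.mem_of_mem_erase he)
      t_mem := fun e he => h.t_mem e (Finset.mem_of_mem_erase he)
      sum_c := h.sum_c
      a_nonneg := fun y hy => by
        have := h.a_nonneg y hy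
        simp only [hQ]
        split_ifs <;> subst_vars <;> lia
      g_nonneg := h.g_nonneg
      halfArcs := by
        have := h.halfArcs
        simpa only [hQ, Finset.sum_add_distrib, Finset.sum_sub_distrib, Finset.sum_ite_eq, hxS,
          hvS, if_true, sub_add_cancel] using this
      subset := h.subset
      card_le := by simp
      balanced := fun y hy => by
        obtain ⟨m, h1, h2⟩ := h.balanced y hy
        obtain rfl := Finset.mem_singleton.1 hy
        refine ⟨m - 1, ?_, ?_⟩
        · rw [hin, hout]; simp [ht]; linarith
        · rw [hout]; simp only [ht, Finset.mem_singleton, not_false_eq_true, and_self, if_true]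
          rwa [sub_sub_sub_cancel_right]
      room := fun B hB h1 h2 h3 => by
        by_cases h4 : x ∈ B ∧ v ∉ B
        · exact (h.room_one_one hk hB (two_le_card h4.1 h3) h2).transfer 0 (by simp [hQ])
            (by rw [hin, if_pos h4]; linarith) (by rw [hout, if_pos h4]; linarith)
        · exact (h.room B hB h1 h2 h3).transfer 0 (by simp [hQ])
            (by rw [hin, if_neg h4]; linarith) (by rw [hout, if_neg h4]; linarith) }
  obtain ⟨Y, hY, hsol⟩ := h.minimal Q _ (Or.inr ⟨rfl, Finset.card_erase_lt_of_mem he⟩) hadm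
  exact h.not_solvable ⟨Y, hY.trans (Finset.erase_subset _ _), hsol⟩

theorem Critical.a_le_zero {P : FlowProblem W E} {k : ℤ} {x y : W} (h : P.Critical k {x})
    (hk : 0 < k) {e : E} (he : e ∈ P.F) (hxy : P.Joins e x y) (hne : y ≠ x) : P.a x ≤ 0 := by
  obtain ⟨Q, hQ, -, hF, ha, -, hs, ht, -⟩ := h.orient he hxy
  rw [← ha]
  exact hQ.a_le_zero_of_s_eq hk (hF ▸ he) hs (ht ▸ hne)

theorem Critical.g_le_zero {P : FlowProblem W E} {k : ℤ} {x y : W} (h : P.Critical k {x})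
    (hk : 0 < k) {e : E} (he : e ∈ P.F) (hxy : P.Joins e x y) (hne : y ≠ x) : P.g x ≤ 0 :=
  h.rev.a_le_zero hk he (hxy.symm.imp And.symm And.symm) hne

theorem Critical.false_of_path {P : FlowProblem W E} {k : ℤ} {x u v : W} (h : P.Critical k {x})
    (hk : 0 < k) {d e : E} (hd : d ∈ P.F) (he : e ∈ P.F) (hsd : P.s d = u) (htd : P.t d = x)
    (hse : P.s e = x) (hte : P.t e = v) (hux : u ≠ x) (hvx : v ≠ x) (huv : u ≠ v) : False := by
  have hde : d ≠ e := by rintro rfl; exact hux (hsd.symm.trans hse)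
  have hvS : v ∈ P.S := hte ▸ h.t_mem e he
  set Q : FlowProblem W E := { P with
    F := P.F.erase e
    t := Function.update P.t d v } with hQ
  have hin : ∀ B, Q.inCap B = P.inCap B -
      if x ∈ B ∧ u ∉ B ∧ v ∉ B ∨ x ∉ B ∧ u ∈ B ∧ v ∈ B then 1 else 0 := fun B => by
    have h1 := Finset.add_sum_erase P.F (fun e => if Q.t e ∈ B ∧ Q.s e ∉ B then (1 : ℤ) else 0) he
    have h2 := sum_eq_sum_add_of_eq_off hd
      (f := fun e => if P.t e ∈ B ∧ P.s e ∉ B then (1 : ℤ) else 0)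
      (f' := fun e => if Q.t e ∈ B ∧ Q.s e ∉ B then (1 : ℤ) else 0)
      (fun c _ hc => by simp [hQ, hc])
    rw [h2] at h1
    simp only [inCap, outDeg]
    rw [show Q.F = P.F.erase e from rfl, eq_sub_of_add_eq' h1]
    simp only [hQ, ne_eq, hde.symm, not_false_eq_true, Function.update_of_ne,
      Function.update_self, hsd, htd, hse, hte]
    by_cases h3 : x ∈ B <;> by_cases h4 : u ∈ B <;> by_cases h5 : v ∈ B <;>
      simp [h3, h4, h5] <;> ring
  have hout : ∀ B, Q.outCap B = P.outCap B -
      if x ∈ B ∧ u ∉ B ∧ v ∉ B ∨ x ∉ B ∧ u ∈ B ∧ v ∈ B then 1 else 0 := fun B => by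
    have h1 := Finset.add_sum_erase P.F (fun e => if Q.s e ∈ B ∧ Q.t e ∉ B then (1 : ℤ) else 0) he
    have h2 := sum_eq_sum_add_of_eq_off hd
      (f := fun e => if P.s e ∈ B ∧ P.t e ∉ B then (1 : ℤ) else 0)
      (f' := fun e => if Q.s e ∈ B ∧ Q.t e ∉ B then (1 : ℤ) else 0)
      (fun c _ hc => by simp [hQ, hc])
    rw [h2] at h1
    simp only [outCap, outDeg]
    rw [show Q.F = P.F.erase e from rfl, eq_sub_of_add_eq' h1]
    simp only [hQ, ne_eq, hde.symm, not_false_eq_true, Function.update_of_ne,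
      Function.update_self, hsd, htd, hse, hte]
    by_cases h3 : x ∈ B <;> by_cases h4 : u ∈ B <;> by_cases h5 : v ∈ B <;>
      simp [h3, h4, h5] <;> ring
  have hadm : Q.Admissible k {x} :=
    { s_mem := fun c hc => h.s_mem c (Finset.mem_of_mem_erase hc)
      t_mem := fun c hc => by
        by_cases hcd : c = d
        · simpa [hQ, hcd] using hvS
        · simpa [hQ, hcd] using h.t_mem c (Finset.mem_of_mem_erase hc)
      sum_c := h.sum_c
      a_nonneg := h.a_nonneg
      g_nonneg := h.g_nonneg
      halfArcs := h.halfArcs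
      subset := h.subset
      card_le := by simp
      balanced := fun y hy => by
        obtain ⟨m, h1, h2⟩ := h.balanced y hy
        obtain rfl := Finset.mem_singleton.1 hy
        refine ⟨m - 1, ?_, ?_⟩
        · rw [hin, hout]; simp [hux, hvx]; linarith
        · rw [hout]
          simp only [hux, hvx, Finset.mem_singleton, not_false_eq_true, and_self, true_or,
            if_true]
          rwa [sub_sub_sub_cancel_right]
      room := fun B hB h1 h2 h3 => by
        by_cases h4 : x ∈ B ∧ u ∉ B ∧ v ∉ B ∨ x ∉ B ∧ u ∈ B ∧ v ∈ B
        · refine (h.room_one_one hk hB ?_ h2).transfer 0 (by simp [hQ])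
            (by rw [hin, if_pos h4]; linarith) (by rw [hout, if_pos h4]; linarith)
          rcases h4 with h4 | h4
          · exact two_le_card h4.1 h3
          · exact Finset.one_lt_card.2 ⟨u, h4.2.1, v, h4.2.2, huv⟩
        · exact (h.room B hB h1 h2 h3).transfer 0 (by simp [hQ])
            (by rw [hin, if_neg h4]; linarith) (by rw [hout, if_neg h4]; linarith) }
  obtain ⟨Y, hY, hsol⟩ := h.minimal Q _ (Or.inr ⟨rfl, Finset.card_erase_lt_of_mem he⟩) hadm
  have heY : e ∉ Y := fun h' => Finset.notMem_erase e _ (hY h')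
  have hYF : Y ⊆ P.F := hY.trans (Finset.erase_subset _ _)
  by_cases hdY : d ∈ Y
  · refine h.not_solvable ⟨insert e Y, Finset.insert_subset he hYF, fun y hy => ?_⟩
    have h1 := hsol y hy
    rw [netOut, sum_eq_sum_add_of_eq_off hdY
      (f := fun e => (if P.s e = y then (1 : ℤ) else 0) - if P.t e = y then 1 else 0)
      (fun c _ hc => by simp [hQ, hc])] at h1
    rw [netOut_insert heY]
    convert h1 using 1
    simp only [hQ, netOut, Function.update_self, hsd, htd, hse, hte]
    ring
  · refine h.not_solvable ⟨Y, hYF, fun y hy => ?_⟩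
    have h1 := hsol y hy
    rwa [netOut_congr (s' := P.s) (t' := P.t) (fun _ _ => rfl) fun c hc => by
      simp [hQ, ne_of_mem_of_not_mem hc hdY]] at h1

theorem Critical.eq_of_joins {P : FlowProblem W E} {k : ℤ} {x u v : W} (h : P.Critical k {x})
    (hk : 0 < k) {d e : E} (hd : d ∈ P.F) (he : e ∈ P.F) (hdx : P.Joins d u x)
    (hex : P.Joins e x v) (hux : u ≠ x) (hvx : v ≠ x) : u = v := by
  by_contra huv
  have hde : d ≠ e := by
    rintro rfl
    rcases hdx with ⟨h1, h2⟩ | ⟨h1, h2⟩ <;> rcases hex with ⟨h3, h4⟩ | ⟨h3, h4⟩ <;> simp_all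
  obtain ⟨Q, hQ, -, hF, -, -, hs, ht, hoff, -⟩ := h.orient hd hdx
  have hex' : Q.Joins e x v := by
    rwa [Joins, (hoff e hde.symm).1, (hoff e hde.symm).2]
  obtain ⟨R, hR, -, hF', -, -, hs', ht', hoff', -⟩ := hQ.orient (hF ▸ he) hex'
  exact hR.false_of_path hk (hF' ▸ hF ▸ hd) (hF' ▸ hF ▸ he) ((hoff' d hde).1.trans hs)
    ((hoff' d hde).2.trans ht) hs' ht' hux hvx huv

theorem Critical.exists_netOut_dvd {P : FlowProblem W E} {k : ℤ} {x : W} (h : P.Critical k {x})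
    (ha : P.a x = 0) (hg : P.g x = 0) :
    ∃ Y ⊆ P.F, (∀ e ∈ Y, P.s e = x ∨ P.t e = x) ∧ k ∣ netOut P.s P.t Y x - P.c x := by
  obtain ⟨m, h1, h2⟩ := h.balanced x (by simp)
  set O : Finset E := {e ∈ P.F | P.s e = x ∧ P.t e ≠ x} with hO
  set I : Finset E := {e ∈ P.F | P.t e = x ∧ P.s e ≠ x} with hI
  have hout : P.outCap {x} = O.card := by simp [outCap, outDeg, hg, hO]
  have hin : P.inCap {x} = I.card := by simp [inCap, outDeg, ha, hI]
  rw [hin, hout] at h1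
  rw [hout, ← dvd_neg, neg_sub] at h2
  rcases le_total I.card O.card with hle | hle
  · obtain ⟨Y, hY, hcard⟩ :=
      Finset.exists_subset_card_eq (s := O) (n := O.card - m.toNat) (by omega)
    refine ⟨Y, hY.trans (Finset.filter_subset _ _), fun e he =>
      Or.inl (Finset.mem_filter.1 (hY he)).2.1, ?_⟩
    have : netOut P.s P.t Y x = Y.card := by
      rw [netOut, Finset.sum_congr rfl fun e he => ?_]
      · exact (Finset.card_eq_sum_ones Y ▸ by simp : ∑ _ ∈ Y, (1 : ℤ) = Y.card)
      · simp [(Finset.mem_filter.1 (hY he)).2]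
    rwa [this, hcard, show ((O.card - m.toNat : ℕ) : ℤ) = O.card - m by omega]
  · obtain ⟨Y, hY, hcard⟩ :=
      Finset.exists_subset_card_eq (s := I) (n := m.toNat - O.card) (by omega)
    refine ⟨Y, hY.trans (Finset.filter_subset _ _), fun e he =>
      Or.inr (Finset.mem_filter.1 (hY he)).2.1, ?_⟩
    have : netOut P.s P.t Y x = -Y.card := by
      rw [netOut, Finset.sum_congr rfl fun e he => ?_]
      · exact (by simp : ∑ _ ∈ Y, (-1 : ℤ) = -Y.card)
      · simp [(Finset.mem_filter.1 (hY he)).2]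
    rwa [this, hcard, show -((m.toNat - O.card : ℕ) : ℤ) = O.card - m by omega]

theorem Critical.false_of_pendant {P : FlowProblem W E} {k : ℤ} {x v : W} (h : P.Critical k {x})
    (ha : P.a x = 0) (hg : P.g x = 0) (hv : v ∈ P.S) (hvx : v ≠ x)
    (hs : ∀ e ∈ P.F, P.s e = x → P.t e = x ∨ P.t e = v)
    (ht : ∀ e ∈ P.F, P.t e = x → P.s e = x ∨ P.s e = v) : False := by
  have hxS : x ∈ P.S := h.subset (by simp)
  obtain ⟨Y₀, hY₀, hY₀x, hdvd⟩ := h.exists_netOut_dvd ha hg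
  obtain ⟨Y, hY, hsol, hsolB⟩ := h.exists_collapse (B := {x, v}) (by
    simp [Finset.insert_subset_iff, hv, hxS]) (by rw [Finset.card_pair hvx.symm])
  rw [Finset.sum_pair hvx.symm, Finset.sum_pair hvx.symm] at hsolB
  have hnear : ∀ T ⊆ P.F, (∀ e ∈ T, P.s e = x ∨ P.t e = x) →
      (∀ w, w ≠ x → w ≠ v → netOut P.s P.t T w = 0) ∧
        netOut P.s P.t T x + netOut P.s P.t T v = 0 := by
    intro T hT hTx
    have hend : ∀ e ∈ T, (P.s e = x ∨ P.s e = v) ∧ (P.t e = x ∨ P.t e = v) := fun e he => by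
      rcases hTx e he with h1 | h1
      · exact ⟨Or.inl h1, hs e (hT he) h1⟩
      · exact ⟨ht e (hT he) h1, Or.inl h1⟩
    constructor
    · intro w hwx hwv
      refine Finset.sum_eq_zero fun e he => ?_
      obtain ⟨h1 | h1, h2 | h2⟩ := hend e he <;> simp [h1, h2, hwx.symm, hwv.symm]
    · rw [← Finset.sum_pair hvx.symm, sum_netOut]
      refine Finset.sum_eq_zero fun e he => ?_
      obtain ⟨h1 | h1, h2 | h2⟩ := hend e he <;> simp [h1, h2]
  set far : Finset E := {e ∈ Y | ¬ (P.s e = x ∨ P.t e = x)} with hfar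
  have hfarx : netOut P.s P.t far x = 0 := Finset.sum_eq_zero fun e he => by
    have := (Finset.mem_filter.1 he).2
    simp only [not_or] at this
    simp [this]
  obtain ⟨n1, n2⟩ := hnear {e ∈ Y | P.s e = x ∨ P.t e = x}
    ((Finset.filter_subset _ _).trans hY) fun e he => (Finset.mem_filter.1 he).2
  obtain ⟨m1, m2⟩ := hnear Y₀ hY₀ hY₀x
  have hsplit : ∀ w, netOut P.s P.t {e ∈ Y | P.s e = x ∨ P.t e = x} w + netOut P.s P.t far w =
      netOut P.s P.t Y w := fun w => Finset.sum_filter_add_sum_filter_not Y _ _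
  have hun : ∀ w, netOut P.s P.t (far ∪ Y₀) w = netOut P.s P.t far w + netOut P.s P.t Y₀ w :=
    fun w => Finset.sum_union <| Finset.disjoint_left.2 fun e h1 h2 =>
      (Finset.mem_filter.1 h1).2 (hY₀x e h2)
  refine h.not_solvable ⟨far ∪ Y₀,
    Finset.union_subset ((Finset.filter_subset _ _).trans hY) hY₀, fun w hw => ?_⟩
  rw [hun]
  by_cases hwx : w = x
  · subst hwx
    rwa [hfarx, zero_add]
  by_cases hwv : w = v
  · subst hwv
    have h1 := hsplit x
    have h2 := hsplit w
    rw [show netOut P.s P.t far w + netOut P.s P.t Y₀ w - P.c w =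
      netOut P.s P.t Y x + netOut P.s P.t Y w - (P.c x + P.c w) -
        (netOut P.s P.t Y₀ x - P.c x) by linarith]
    exact dvd_sub hsolB hdvd
  · have h1 := hsplit w
    rw [n1 w hwx hwv, zero_add] at h1
    rw [m1 w hwx hwv, add_zero, h1]
    exact hsol w hw (by simp [hwx, hwv])

theorem eq_zero_of_dvd_of_bounds {k h n : ℤ} (hk : 0 < k) (h0 : 0 ≤ h) (hd : k ∣ n - h)
    (hn : n ≤ 0 ∧ 2 * h - k ≤ n ∨ 2 * h ≤ n ∧ n ≤ k) : h = 0 := by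
  obtain ⟨j, hj⟩ := hd
  rcases hn with ⟨h1, h2⟩ | ⟨h1, h2⟩
  · by_contra hne
    have : 0 < h := lt_of_le_of_ne h0 (Ne.symm hne)
    have h3 : j < 0 := by by_contra! hc; nlinarith
    nlinarith
  · by_contra hne
    have : 0 < h := lt_of_le_of_ne h0 (Ne.symm hne)
    have h3 : 0 < j := by by_contra! hc; nlinarith
    nlinarith

theorem outDeg_eq_zero {s t : E → W} {F : Finset E} {B : Finset W}
    (h : ∀ e ∈ F, s e ∈ B ↔ t e ∈ B) : outDeg s t F B = 0 :=
  Finset.sum_eq_zero fun e he => if_neg fun h' => h'.2 ((h e he).1 h'.1)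

theorem Room.bounds_of_no_arc {P : FlowProblem W E} {k : ℤ} {B : Finset W} (h : P.Room k 0 0 B)
    (hB : ∀ e ∈ P.F, P.s e ∈ B ↔ P.t e ∈ B) :
    ∃ n, k ∣ n - ∑ x ∈ B, P.c x ∧ k - 1 - ∑ x ∈ B, P.a x ≤ n ∧ n ≤ ∑ x ∈ B, P.g x - (k - 1) := by
  obtain ⟨n, h1, h2, h3⟩ := h
  rw [inCap, outDeg_eq_zero fun e he => (hB e he).symm] at h2
  rw [outCap, outDeg_eq_zero hB] at h3
  exact ⟨n, h1, by linarith, by linarith⟩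

theorem Critical.halfArcs_eq_zero_of_isolated {P : FlowProblem W E} {k : ℤ} {x : W}
    (h : P.Critical k {x}) (hk : 0 < k) (hcard : 2 ≤ P.S.card)
    (hiso : ∀ e ∈ P.F, P.s e = x ↔ P.t e = x) : P.a x = 0 ∧ P.g x = 0 := by
  have hxS : x ∈ P.S := h.subset (by simp)
  have hne : (P.S.erase x).Nonempty := Finset.card_pos.1 (by
    rw [Finset.card_erase_of_mem hxS]; omega)
  have hx : x ∉ P.S.erase x := Finset.notMem_erase _ _
  obtain ⟨n, h1, h2, h3⟩ := (h.room _ (Finset.erase_subset _ _) hne (fun h' => hx (by rwa [h']))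
    (fun h' => hx (by rw [h']; simp))).bounds_of_no_arc fun e he => by
      simp [h.s_mem e he, h.t_mem e he, hiso e he]
  have ha := Finset.add_sum_erase P.S P.a hxS
  have hg := Finset.add_sum_erase P.S P.g hxS
  have hc := Finset.add_sum_erase P.S P.c hxS
  obtain ⟨m, h4, h5⟩ := h.balanced x (by simp)
  rw [inCap, outCap, outDeg_eq_zero (by simpa using fun e he => (hiso e he).symm),
    outDeg_eq_zero (by simpa using hiso)] at h4
  rw [outCap, outDeg_eq_zero (by simpa using hiso)] at h5
  simp only [Finset.sum_singleton, zero_add] at h4 h5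
  have ha0 := h.a_nonneg x hxS
  have hg0 := h.g_nonneg x hxS
  have hm : m = 0 := by
    refine eq_zero_of_dvd_of_bounds (n := n + P.g x) hk (by linarith) ?_ ?_
    · rw [show n + P.g x - m = n - ∑ y ∈ P.S.erase x, P.c y + ∑ y ∈ P.S, P.c y -
        (P.c x - (P.g x - m)) by linarith]
      exact dvd_sub (dvd_add h1 h.sum_c) h5
    · rcases h.halfArcs with ⟨h6, h7⟩ | ⟨h6, h7⟩
      · left; constructor <;> linarith
      · right; constructor <;> linarith
  constructor <;> linarith

theorem Critical.false_of_exempt {P : FlowProblem W E} {k : ℤ} {x : W}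
    (h : P.Critical k {x}) (hk : 0 < k) (hcard : 2 ≤ P.S.card) : False := by
  have hxS : x ∈ P.S := h.subset (by simp)
  by_cases hiso : ∀ e ∈ P.F, P.s e = x ↔ P.t e = x
  · obtain ⟨ha, hg⟩ := h.halfArcs_eq_zero_of_isolated hk hcard hiso
    obtain ⟨v, hv, hvx⟩ := Finset.exists_mem_ne hcard x
    exact h.false_of_pendant ha hg hv hvx (fun e he h1 => Or.inl ((hiso e he).1 h1))
      (fun e he h1 => Or.inl ((hiso e he).2 h1))
  · obtain ⟨e, he, v, hv, hxv⟩ : ∃ e ∈ P.F, ∃ v, v ≠ x ∧ P.Joins e x v := by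
      push Not at hiso
      obtain ⟨e, he, ⟨h1, h2⟩ | ⟨h1, h2⟩⟩ := hiso
      · exact ⟨e, he, _, h2, Or.inl ⟨h1, rfl⟩⟩
      · exact ⟨e, he, _, h1, Or.inr ⟨rfl, h2⟩⟩
    have ha : P.a x = 0 := le_antisymm (h.a_le_zero hk he hxv hv) (h.a_nonneg x hxS)
    have hg : P.g x = 0 := le_antisymm (h.g_le_zero hk he hxv hv) (h.g_nonneg x hxS)
    have hvS : v ∈ P.S := by
      rcases hxv with ⟨-, h1⟩ | ⟨h1, -⟩
      · exact h1 ▸ h.t_mem e he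
      · exact h1 ▸ h.s_mem e he
    refine h.false_of_pendant ha hg hvS hv (fun d hd h1 => ?_) fun d hd h1 => ?_
    · by_contra! h2
      exact h2.2 (h.eq_of_joins hk hd he (Or.inr ⟨h1, rfl⟩) hxv h2.1 hv)
    · by_contra! h2
      exact h2.2 (h.eq_of_joins hk hd he (Or.inl ⟨rfl, h1⟩) hxv h2.1 hv)

/-! ### Critical problems do not exist -/

theorem Critical.room_singleton {P : FlowProblem W E} {k : ℤ} (h : P.Critical k ∅) (hk : 0 < k)
    (hcard : 2 ≤ P.S.card) {x : W} (hx : x ∈ P.S) : P.Room k 1 0 {x} ∨ P.Room k 0 1 {x} := by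
  by_contra! hno
  obtain ⟨n, h1, h2, h3⟩ := h.room {x} (by simpa using hx) (by simp)
    (by intro h'; rw [← h'] at hcard; simp at hcard) (by simp)
  have h4 : n ≤ k - 1 - P.inCap {x} := by
    by_contra hc
    exact hno.1 ⟨n, h1, by linarith, by linarith⟩
  have h5 : P.outCap {x} - (k - 1) ≤ n := by
    by_contra hc
    exact hno.2 ⟨n, h1, by linarith, by linarith⟩
  have hbal : P.Critical k {x} :=
    { h with
      subset := by simpa using hx
      card_le := by simp
      balanced := fun y hy => by
        obtain rfl := Finset.mem_singleton.1 hy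
        refine ⟨k - 1, by linarith, ?_⟩
        rw [Finset.sum_singleton] at h1
        rw [show P.c y - (P.outCap {y} - (k - 1)) = -(n - P.c y) by linarith]
        exact h1.neg_right
      room := fun B hB h1 h2 _ => h.room B hB h1 h2 h1.ne_empty }
  exact hbal.false_of_exempt hk hcard

theorem Critical.not_room_of_joins {P : FlowProblem W E} {k : ℤ} (h : P.Critical k ∅) (hk : 0 < k)
    {e : E} (he : e ∈ P.F) {x y : W} (hxy : P.Joins e x y) (hx : P.Room k 0 1 {x}) :
    ¬ P.Room k 1 0 {y} := by
  intro hy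
  obtain ⟨R, hR, -, hF, -, -, hs, ht, -, hroom⟩ := h.orient he hxy
  replace hx := hroom _ _ _ hx
  replace hy := hroom _ _ _ hy
  rw [← hF] at he
  set Q : FlowProblem W E := { R with F := R.F.erase e } with hQ
  have hin : ∀ B, Q.inCap B = R.inCap B - if y ∈ B ∧ x ∉ B then 1 else 0 := fun B => by
    have h1 := Finset.add_sum_erase R.F (fun e => if R.t e ∈ B ∧ R.s e ∉ B then (1 : ℤ) else 0) he
    simp only [inCap, outDeg, hQ]
    rw [← h1]
    simp only [hs, ht]
    ring
  have hout : ∀ B, Q.outCap B = R.outCap B - if x ∈ B ∧ y ∉ B then 1 else 0 := fun B => by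
    have h1 := Finset.add_sum_erase R.F (fun e => if R.s e ∈ B ∧ R.t e ∉ B then (1 : ℤ) else 0) he
    simp only [outCap, outDeg, hQ]
    rw [← h1]
    simp only [hs, ht]
    ring
  have hadm : Q.Admissible k ∅ :=
    { s_mem := fun d hd => hR.s_mem d (Finset.mem_of_mem_erase hd)
      t_mem := fun d hd => hR.t_mem d (Finset.mem_of_mem_erase hd)
      sum_c := hR.sum_c
      a_nonneg := hR.a_nonneg
      g_nonneg := hR.g_nonneg
      halfArcs := hR.halfArcs
      subset := by simp
      card_le := by simp
      balanced := by simp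
      room := fun B hB h1 h2 h3 => by
        by_cases hxB : x ∈ B <;> by_cases hyB : y ∈ B
        · exact (hR.room B hB h1 h2 h3).transfer 0 (by simp [hQ])
            (by simp [hin, hxB, hyB]) (by simp [hout, hxB, hyB])
        · have : R.Room k 0 1 B := by
            by_cases hB' : B = {x}
            · rwa [hB']
            · exact (hR.room_one_one hk hB (two_le_card hxB hB') h2).mono (by simp) le_rfl
          exact this.transfer 0 (by simp [hQ])
            (by simp [hin, hxB, hyB]) (by simp [hout, hxB, hyB])
        · have : R.Room k 1 0 B := by
            by_cases hB' : B = {y}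
            · rwa [hB']
            · exact (hR.room_one_one hk hB (two_le_card hyB hB') h2).mono le_rfl (by simp)
          exact this.transfer 0 (by simp [hQ])
            (by simp [hin, hxB, hyB]) (by simp [hout, hxB, hyB])
        · exact (hR.room B hB h1 h2 h3).transfer 0 (by simp [hQ])
            (by simp [hin, hxB, hyB]) (by simp [hout, hxB, hyB]) }
  obtain ⟨Y, hY, hsol⟩ := hR.minimal Q _ (Or.inr ⟨rfl, Finset.card_erase_lt_of_mem he⟩) hadm
  exact hR.not_solvable ⟨Y, hY.trans (Finset.erase_subset _ _), hsol⟩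

theorem Critical.exists_joins {P : FlowProblem W E} {k : ℤ} (h : P.Critical k ∅) (hk : 3 ≤ k)
    {B : Finset W} (hB : B ⊆ P.S) (hne : B.Nonempty) (hne' : B ≠ P.S) :
    ∃ e ∈ P.F, ∃ x ∈ B, ∃ y ∈ P.S, y ∉ B ∧ P.Joins e x y := by
  by_contra! hno
  have hiff : ∀ e ∈ P.F, P.s e ∈ B ↔ P.t e ∈ B := fun e he => by
    constructor <;> intro h1 <;> by_contra h2
    · exact hno e he _ h1 _ (h.t_mem e he) h2 (Or.inl ⟨rfl, rfl⟩)
    · exact hno e he _ h1 _ (h.s_mem e he) h2 (Or.inr ⟨rfl, rfl⟩)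
  have hcompl : (P.S \ B).Nonempty := Finset.sdiff_nonempty.2 fun h' =>
    hne' (Finset.Subset.antisymm hB h')
  obtain ⟨n, -, h1, h2⟩ := (h.room B hB hne hne' hne.ne_empty).bounds_of_no_arc hiff
  obtain ⟨m, -, h3, h4⟩ := (h.room (P.S \ B) Finset.sdiff_subset hcompl (fun h' => by
    obtain ⟨x, hx⟩ := hne
    have := hB hx
    rw [← h'] at this
    exact (Finset.mem_sdiff.1 this).2 hx) hcompl.ne_empty).bounds_of_no_arc fun e he => by
      simp [h.s_mem e he, h.t_mem e he, hiff e he]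
  have ha := Finset.sum_sdiff (f := P.a) hB
  have hg := Finset.sum_sdiff (f := P.g) hB
  rcases h.halfArcs with ⟨h5, h6⟩ | ⟨h5, h6⟩ <;> linarith

theorem Critical.not_room_and_room {P : FlowProblem W E} {k : ℤ} (h : P.Critical k ∅) (hk : 3 ≤ k)
    (hcard : 2 ≤ P.S.card) {x : W} (hx : x ∈ P.S) (hup : P.Room k 1 0 {x}) :
    ¬ P.Room k 0 1 {x} := by
  intro hdn
  obtain ⟨e, he, x', hx', y, hy, -, hxy⟩ := h.exists_joins hk (B := {x}) (by simpa using hx)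
    (by simp) (by intro h'; rw [← h'] at hcard; simp at hcard)
  obtain rfl := Finset.mem_singleton.1 hx'
  rcases h.room_singleton (by linarith) hcard hy with h1 | h1
  · exact h.not_room_of_joins (by linarith) he hxy hdn h1
  · exact h.not_room_of_joins (by linarith) he hxy.symm h1 hup

theorem Critical.forall_room_of_room {P : FlowProblem W E} {k : ℤ} (h : P.Critical k ∅)
    (hk : 3 ≤ k) (hcard : 2 ≤ P.S.card) {z : W} (hz : z ∈ P.S) (hup : P.Room k 1 0 {z}) {x : W}
    (hx : x ∈ P.S) : P.Room k 1 0 {x} := by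
  classical
  by_contra hno
  obtain ⟨e, he, u, hu, v, hv, hvB, huv⟩ := h.exists_joins hk
    (B := {y ∈ P.S | P.Room k 1 0 {y}}) (Finset.filter_subset _ _) ⟨z, by simp [hz, hup]⟩
    (fun h' => hno (Finset.filter_eq_self.1 h' x hx))
  have hv' : ¬ P.Room k 1 0 {v} := fun h' => hvB (by simp [hv, h'])
  have hv'' := (h.room_singleton (by linarith) hcard hv).resolve_left hv'
  exact h.not_room_of_joins (by linarith) he huv.symm hv''
    (Finset.mem_filter.1 hu).2

theorem Critical.with_a {P : FlowProblem W E} {k : ℤ} (h : P.Critical k ∅) {a : W → ℤ}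
    (ha : ∀ x ∈ P.S, 0 ≤ a x) (hsum : ∑ x ∈ P.S, a x ≤ ∑ x ∈ P.S, P.a x ∨ ∑ x ∈ P.S, a x + 1 ≤ k)
    (hroom : ∀ B ⊆ P.S, B.Nonempty → B ≠ P.S → { P with a := a }.Room k 0 0 B) :
    { P with a := a }.Critical k ∅ :=
  { h with
    a_nonneg := ha
    halfArcs := by
      change (∑ x ∈ P.S, a x + 1 ≤ 2 * k ∧ ∑ x ∈ P.S, P.g x + 1 ≤ k) ∨
        (∑ x ∈ P.S, a x + 1 ≤ k ∧ ∑ x ∈ P.S, P.g x + 1 ≤ 2 * k)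
      have h1 := Finset.sum_nonneg ha
      have h2 := Finset.sum_nonneg h.g_nonneg
      have := h.halfArcs
      lia
    balanced := by simp
    room := fun B hB h1 h2 _ => hroom B hB h1 h2 }

theorem inCap_with_a (P : FlowProblem W E) (a : W → ℤ) (B : Finset W) :
    { P with a := a }.inCap B = P.inCap B + (∑ x ∈ B, a x - ∑ x ∈ B, P.a x) := by
  simp only [inCap]; ring

theorem Critical.false_of_forall_room {P : FlowProblem W E} {k : ℤ} (h : P.Critical k ∅)
    (hk : 3 ≤ k) (hcard : 2 ≤ P.S.card) (hup : ∀ x ∈ P.S, P.Room k 1 0 {x}) : False := by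
  obtain ⟨n, hn⟩ : ∃ n, n = (∑ x ∈ P.S, P.a x).toNat := ⟨_, rfl⟩
  induction n using Nat.strong_induction_on generalizing P with
  | _ n ih =>
    by_cases hx : ∃ x ∈ P.S, 1 ≤ P.a x
    · obtain ⟨x, hx, hax⟩ := hx
      set a : W → ℤ := fun y => P.a y - if x = y then 1 else 0 with ha
      have hsum : ∀ B, ∑ y ∈ B, a y = ∑ y ∈ B, P.a y - if x ∈ B then 1 else 0 := fun B => by
        simp [ha, Finset.sum_sub_distrib]
      have hsumS := hsum P.S
      rw [if_pos hx] at hsumS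
      have hcrit : { P with a := a }.Critical k ∅ := by
        refine h.with_a (fun y hy => ?_) (Or.inl (by linarith)) fun B hB h1 h2 => ?_
        · have := h.a_nonneg y hy
          simp only [ha]
          split_ifs <;> subst_vars <;> lia
        · by_cases hxB : x ∈ B
          · have : P.Room k 1 0 B := by
              by_cases hB' : B = {x}
              · rw [hB']; exact hup x hx
              · exact (h.room_one_one (by linarith) hB (two_le_card hxB hB') h2).mono le_rfl
                  (by simp)
            exact this.transfer 0 (by simp) (by rw [P.inCap_with_a a, hsum, if_pos hxB]; linarith)
              (by simp [outCap])
          · exact (h.room B hB h1 h2 h1.ne_empty).transfer 0 (by simp)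
              (by rw [P.inCap_with_a a, hsum, if_neg hxB]; linarith) (by simp [outCap])
      obtain ⟨z, hz, hzx⟩ := Finset.exists_mem_ne hcard x
      have hzup : { P with a := a }.Room k 1 0 {z} := (hup z hz).transfer 0 (by simp)
        (by rw [P.inCap_with_a a, hsum, if_neg (by simpa using hzx.symm)]; linarith)
        (by simp [outCap])
      have hpos := Finset.sum_nonneg hcrit.a_nonneg
      refine ih _ ?_ hcrit hcard (fun y hy => hcrit.forall_room_of_room hk hcard hz hzup hy) rfl
      change (∑ y ∈ P.S, a y).toNat < n
      change 0 ≤ ∑ y ∈ P.S, a y at hpos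
      omega
    · push Not at hx
      have ha0 : ∀ x ∈ P.S, P.a x = 0 := fun x hxS =>
        le_antisymm (by linarith [hx x hxS]) (h.a_nonneg x hxS)
      obtain ⟨y, hy⟩ := Finset.card_pos.1 (by omega : 0 < P.S.card)
      set a : W → ℤ := fun x => if y = x then k - 1 else 0 with ha
      have hsum : ∀ B, ∑ x ∈ B, a x = if y ∈ B then k - 1 else 0 := fun B => by simp [ha]
      have hsum0 : ∀ B ⊆ P.S, ∑ x ∈ B, P.a x = 0 := fun B hB =>
        Finset.sum_eq_zero fun x hxB => ha0 x (hB hxB)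
      have hy' : ({y} : Finset W) ⊆ P.S := by simpa using hy
      have hcrit : { P with a := a }.Critical k ∅ := by
        refine h.with_a (fun x hx => ?_) (Or.inr ?_) fun B hB h1 h2 => ?_
        · simp only [ha]; split_ifs <;> linarith
        · rw [hsum, if_pos hy]; linarith
        · refine (h.room B hB h1 h2 h1.ne_empty).transfer 0 (by simp) ?_ (by simp [outCap])
          rw [P.inCap_with_a a, hsum, hsum0 B hB]
          split_ifs <;> linarith
      have hup' : { P with a := a }.Room k 1 0 {y} := by
        refine (hup y hy).transfer 0 (by simp) ?_ (by simp [outCap])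
        rw [P.inCap_with_a a, hsum, hsum0 _ hy', if_pos (by simp)]
        linarith
      refine hcrit.not_room_and_room hk hcard hy hup' ?_
      obtain ⟨m, h1, h2, h3⟩ := hup y hy
      have hout : { P with a := a }.outCap {y} = P.outCap {y} := rfl
      have hin := P.inCap_with_a a {y}
      rw [hsum, hsum0 _ hy', if_pos (by simp)] at hin
      refine ⟨m - k, ?_, by linarith, by linarith⟩
      rw [show m - k - ∑ x ∈ {y}, P.c x = m - ∑ x ∈ {y}, P.c x - k by ring]
      exact dvd_sub_self_right.2 h1

theorem Critical.false {P : FlowProblem W E} {k : ℤ} {Z : Finset W} (h : P.Critical k Z)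
    (hk : 3 ≤ k) : False := by
  by_cases hcard : 2 ≤ P.S.card
  · have hZ := h.card_le
    rcases Finset.eq_empty_or_nonempty Z with rfl | ⟨x, hx⟩
    · obtain ⟨y, hy⟩ := Finset.card_pos.1 (by omega : 0 < P.S.card)
      rcases h.room_singleton (by linarith) hcard hy with h1 | h1
      · exact h.false_of_forall_room hk hcard fun x hx => h.forall_room_of_room hk hcard hy h1 hx
      · exact h.rev.false_of_forall_room hk hcard fun x hx =>
          h.rev.forall_room_of_room hk hcard hy h1.rev hx
    · obtain rfl : Z = {x} := by
        by_contra hne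
        have := two_le_card hx hne
        omega
      exact h.false_of_exempt (by linarith) hcard
  · refine h.not_solvable ⟨∅, by simp, fun x hx => ?_⟩
    have h1 : P.S = {x} := by
      by_contra hne
      exact hcard (two_le_card hx hne)
    have h2 := h.sum_c
    rw [h1, Finset.sum_singleton] at h2
    simpa [netOut] using h2

theorem Admissible.solvable {P : FlowProblem W E} {k : ℤ} {Z : Finset W} (h : P.Admissible k Z)
    (hk : 3 ≤ k) : P.Solvable k := by
  obtain ⟨n, hn⟩ : ∃ n, n = P.S.card := ⟨_, rfl⟩
  obtain ⟨m, hm⟩ : ∃ m, m = P.F.card := ⟨_, rfl⟩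
  induction n using Nat.strong_induction_on generalizing P Z m with
  | _ n ihn =>
    induction m using Nat.strong_induction_on generalizing P Z with
    | _ m ihm =>
      by_contra hno
      refine Critical.false { h with not_solvable := hno, minimal := fun Q Z' hQ hadm => ?_ } hk
      rcases hQ with h1 | ⟨h1, h2⟩
      · exact ihn _ (hn ▸ h1) hadm rfl _ rfl
      · exact ihm _ (hm ▸ h2) hadm (hn.trans h1.symm) rfl

end FlowProblem

/-! ### Integral flows -/

theorem outDeg_mono (s t : E → W) {F F' : Finset E} (h : F ⊆ F') (B : Finset W) :
    outDeg s t F B ≤ outDeg s t F' B :=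
  Finset.sum_le_sum_of_subset_of_nonneg h fun e _ _ => by split_ifs <;> simp

theorem outDeg_insert (s t : E → W) {F : Finset E} {e : E} (he : e ∉ F) (B : Finset W) :
    outDeg s t (insert e F) B = (if s e ∈ B ∧ t e ∉ B then 1 else 0) + outDeg s t F B :=
  Finset.sum_insert he

theorem outDeg_inter_add_union_le (s t : E → W) (F : Finset E) (B C : Finset W) :
    outDeg s t F (B ∩ C) + outDeg s t F (B ∪ C) ≤ outDeg s t F B + outDeg s t F C := by
  simp only [outDeg, ← Finset.sum_add_distrib]
  refine Finset.sum_le_sum fun e _ => ?_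
  by_cases h1 : s e ∈ B <;> by_cases h2 : s e ∈ C <;> by_cases h3 : t e ∈ B <;>
    by_cases h4 : t e ∈ C <;> simp [h1, h2, h3, h4]

theorem exists_netOut_eq [Fintype W] (s t : E → W) (F : Finset E) (D : W → ℤ)
    (h0 : ∑ v, D v = 0) (hD : ∀ B : Finset W, ∑ v ∈ B, D v ≤ outDeg s t F B) :
    ∃ Z ⊆ F, ∀ v, netOut s t Z v = D v := by
  induction F using Finset.induction_on generalizing D with
  | empty =>
    have h1 : ∀ v ∈ univ, D v ≤ 0 := fun v _ => by simpa [outDeg] using hD {v}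
    exact ⟨∅, subset_rfl, fun v => by
      simpa [netOut] using ((Finset.sum_eq_zero_iff_of_nonpos h1).1 h0 v (mem_univ v)).symm⟩
  | insert e F he ih =>
    simp only [outDeg_insert s t he] at hD
    by_cases h1 : ∀ B : Finset W, ∑ v ∈ B, D v ≤ outDeg s t F B
    · obtain ⟨Z, hZ, h⟩ := ih D h0 h1
      exact ⟨Z, hZ.trans (Finset.subset_insert _ _), h⟩
    set D' : W → ℤ := fun v => D v - (if s e = v then 1 else 0) + if t e = v then 1 else 0 with hD'
    have hsum : ∀ B, ∑ v ∈ B, D' v =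
        ∑ v ∈ B, D v - (if s e ∈ B then 1 else 0) + if t e ∈ B then 1 else 0 := fun B => by
      simp [hD', Finset.sum_add_distrib, Finset.sum_sub_distrib]
    by_cases h2 : ∀ B : Finset W, ∑ v ∈ B, D' v ≤ outDeg s t F B
    · obtain ⟨Z, hZ, h⟩ := ih D' (by simp [hsum, h0]) h2
      refine ⟨insert e Z, Finset.insert_subset_insert _ hZ, fun v => ?_⟩
      rw [netOut_insert fun h' => he (hZ h'), h, hD']
      ring
    exfalso
    push Not at h1 h2
    obtain ⟨B, hB⟩ := h1
    obtain ⟨C, hC⟩ := h2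
    rw [hsum] at hC
    have hB' := hD B
    have hC' := hD C
    have b1 : s e ∈ B ∧ t e ∉ B := by by_contra hc; rw [if_neg hc] at hB'; linarith
    have c1 : s e ∉ C ∧ t e ∈ C := by
      by_cases c1 : s e ∈ C <;> by_cases c2 : t e ∈ C <;> simp [c1, c2] at hC hC' ⊢ <;> linarith
    have hi := hD (B ∩ C)
    have hu := hD (B ∪ C)
    have hm := Finset.sum_union_inter (s₁ := B) (s₂ := C) (f := D)
    have hsub := outDeg_inter_add_union_le s t F B C
    simp [b1, c1] at hi hu hC
    linarith

/-- A modulo `2p + 1` orientation of a `6p`-edge-connected graph, as a set of arcs. -/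
theorem exists_dvd_netOut [Fintype W] [Fintype E] (s t : E → W) {p : ℕ} (hp : 0 < p)
    (hconn : ∀ B : Finset W, B.Nonempty → B ≠ univ →
      6 * (p : ℤ) ≤ outDeg s t univ B + outDeg t s univ B) :
    ∃ Y : Finset E, ∀ v, (2 * p + 1 : ℤ) ∣ netOut s t Y v + p * netOut s t univ v := by
  let P : FlowProblem W E := ⟨univ, univ, s, t, fun v => -(p * netOut s t univ v), 0, 0⟩
  have hP : P.Admissible (2 * p + 1) ∅ :=
    { s_mem := by simp [P]
      t_mem := by simp [P]
      sum_c := by simp [P, ← Finset.mul_sum, sum_netOut]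
      a_nonneg := by simp [P]
      g_nonneg := by simp [P]
      halfArcs := by left; simp [P]; lia
      subset := by simp
      card_le := by simp
      balanced := by simp
      room := fun B _ h1 h2 _ => by
        have h3 := hconn B h1 h2
        have h4 : P.inCap B = outDeg t s univ B := by simp [FlowProblem.inCap, P]
        have h5 : P.outCap B = outDeg s t univ B := by simp [FlowProblem.outCap, P]
        have hk : (0 : ℤ) < 2 * p + 1 := by positivity
        set lo : ℤ := 2 * p - outDeg t s univ B with hlo
        have h6 := Int.emod_nonneg (∑ x ∈ B, P.c x - lo) hk.ne'
        have h7 := Int.emod_lt_of_pos (∑ x ∈ B, P.c x - lo) hk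
        refine ⟨lo + (∑ x ∈ B, P.c x - lo) % (2 * p + 1), ?_, ?_, ?_⟩
        · rw [show lo + (∑ x ∈ B, P.c x - lo) % (2 * p + 1) - ∑ x ∈ B, P.c x =
            -((∑ x ∈ B, P.c x - lo) - (∑ x ∈ B, P.c x - lo) % (2 * p + 1)) by ring]
          exact (Int.dvd_self_sub_emod).neg_right
        · rw [h4]; linarith
        · rw [h5]; linarith }
  obtain ⟨Y, -, hY⟩ := hP.solvable (by lia)
  exact ⟨Y, fun v => by simpa [P] using hY v (mem_univ v)⟩

/-- Some set of arcs contains between `p / (2p + 1)` and `(p + 1) / (2p + 1)` of the arcs of every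
dicut. -/
theorem exists_balanced_arcs [Fintype W] [Fintype E] (s t : E → W) {p : ℕ} (hp : 0 < p)
    (hconn : ∀ B : Finset W, B.Nonempty → B ≠ univ →
      6 * (p : ℤ) ≤ outDeg s t univ B + outDeg t s univ B) :
    ∃ Z : Finset E, ∀ B : Finset W, outDeg t s univ B = 0 →
      p * outDeg s t univ B ≤ (2 * p + 1) * outDeg s t Z B ∧
        (2 * p + 1) * outDeg s t Z B ≤ (p + 1) * outDeg s t univ B := by
  obtain ⟨Y, hY⟩ := exists_dvd_netOut s t hp hconn
  choose D hD using hY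
  have hsum : ∀ B : Finset W, (2 * p + 1 : ℤ) * ∑ v ∈ B, D v =
      outDeg s t Y B - outDeg t s Y B + p * (outDeg s t univ B - outDeg t s univ B) := fun B => by
    rw [← sum_netOut_eq_outDeg_sub, ← sum_netOut_eq_outDeg_sub, Finset.mul_sum, Finset.mul_sum,
      ← Finset.sum_add_distrib]
    exact Finset.sum_congr rfl fun v _ => (hD v).symm
  have hk : (0 : ℤ) < 2 * p + 1 := by positivity
  have hp' : (0 : ℤ) ≤ p := by positivity
  obtain ⟨Z, -, hZ⟩ := exists_netOut_eq s t univ D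
    (by
      have := hsum univ
      simp only [outDeg, mem_univ, not_true_eq_false, and_false, if_false, Finset.sum_const_zero,
        sub_zero, mul_zero, add_zero, mul_eq_zero, hk.ne', false_or] at this
      exact this)
    (fun B => by
      have h1 := hsum B
      have h2 := outDeg_mono s t (Finset.subset_univ Y) B
      have h3 := outDeg_nonneg t s Y B
      have h4 := outDeg_nonneg t s univ B
      have h5 := outDeg_nonneg s t univ B
      nlinarith)
  refine ⟨Z, fun B hB => ?_⟩
  have hin : ∀ T, outDeg t s T B = 0 := fun T => le_antisymm
    (hB ▸ outDeg_mono t s (Finset.subset_univ T) B) (outDeg_nonneg _ _ _ _)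
  have h1 : outDeg s t Z B = ∑ v ∈ B, D v := by
    rw [← sub_zero (outDeg s t Z B), ← hin Z, ← sum_netOut_eq_outDeg_sub]
    exact Finset.sum_congr rfl fun v _ => hZ v
  rw [h1, hsum B, hin, hin]
  have h2 := outDeg_mono s t (Finset.subset_univ Y) B
  have h3 := outDeg_nonneg s t Y B
  constructor <;> linarith

/-! ### Packing covers of rooted dicuts -/

theorem outDeg_pos {s t : E → W} {F : Finset E} {B : Finset W} (h : 0 < outDeg s t F B) :
    ∃ e ∈ F, s e ∈ B ∧ t e ∉ B := by
  by_contra! hno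
  exact h.ne' (Finset.sum_eq_zero fun e he => if_neg fun h' => h'.2 (hno e he h'.1))

theorem exists_mem_of_outDeg_lt {s t : E → W} {F : Finset E} {B C : Finset W}
    (h : outDeg s t F B < outDeg s t F C) :
    ∃ e ∈ F, (s e ∈ C ∧ t e ∉ C) ∧ ¬ (s e ∈ B ∧ t e ∉ B) := by
  by_contra! hno
  refine h.not_ge (Finset.sum_le_sum fun e he => ?_)
  have := hno e he
  split_ifs <;> simp_all

/-- A nonempty vertex set avoiding `r` that no arc enters. -/
def IsRootedDicut (s t : E → W) (r : W) (B : Finset W) : Prop :=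
  B.Nonempty ∧ r ∉ B ∧ ∀ e, t e ∈ B → s e ∈ B

theorem IsRootedDicut.union {s t : E → W} {r : W} {B C : Finset W} (hB : IsRootedDicut s t r B)
    (hC : IsRootedDicut s t r C) : IsRootedDicut s t r (B ∪ C) :=
  ⟨hB.1.mono Finset.subset_union_left, by simp [hB.2.1, hC.2.1], fun e he => by
    simp only [Finset.mem_union] at he ⊢
    exact he.imp (hB.2.2 e) (hC.2.2 e)⟩

theorem IsRootedDicut.inter {s t : E → W} {r : W} {B C : Finset W} (hB : IsRootedDicut s t r B)
    (hC : IsRootedDicut s t r C) (h : (B ∩ C).Nonempty) : IsRootedDicut s t r (B ∩ C) :=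
  ⟨h, by simp [hB.2.1], fun e he => by
    simp only [Finset.mem_inter] at he ⊢
    exact he.imp (hB.2.2 e) (hC.2.2 e)⟩

theorem exists_greatest_isRootedDicut (s t : E → W) (r : W) (U : Finset W) :
    ∃ M ⊆ U, (M = ∅ ∨ IsRootedDicut s t r M) ∧ ∀ B ⊆ U, IsRootedDicut s t r B → B ⊆ M := by
  classical
  refine ⟨({B ∈ U.powerset | IsRootedDicut s t r B}).biUnion id, ?_, ?_, ?_⟩
  · exact Finset.biUnion_subset.2 fun B hB => by simpa using (Finset.mem_filter.1 hB).1
  · have : ∀ T : Finset (Finset W), (∀ B ∈ T, IsRootedDicut s t r B) →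
        T.biUnion id = ∅ ∨ IsRootedDicut s t r (T.biUnion id) := by
      intro T
      induction T using Finset.induction_on with
      | empty => simp
      | insert B T _ ih =>
        intro hT
        right
        rw [Finset.biUnion_insert]
        have hB := hT B (by simp)
        rcases ih fun C hC => hT C (by simp [hC]) with h | h
        · simpa [h] using hB
        · exact hB.union h
    exact this _ fun B hB => (Finset.mem_filter.1 hB).2
  · exact fun B hB h => Finset.subset_biUnion_of_mem id (by simp [hB, h])

/-- One can always extend a partial cover by an arc without destroying the packing number of the
remaining arcs. -/
theorem exists_arc_of_isRootedDicut {s t : E → W} {r : W} {X J : Finset E} {N : ℤ} (hN : 0 ≤ N)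
    (hX : ∀ B, IsRootedDicut s t r B → N + 1 ≤ outDeg s t X B) {U : Finset W}
    (hU : IsRootedDicut s t r U) (hJU : ∀ e ∈ J, s e ∉ U)
    (hJ : ∀ B, IsRootedDicut s t r B → N ≤ outDeg s t (X \ J) B) :
    ∃ e ∈ X \ J, s e ∈ U ∧ t e ∉ U ∧ ∀ B, IsRootedDicut s t r B → outDeg s t (X \ J) B ≤ N →
      ¬ (s e ∈ B ∧ t e ∉ B) := by
  have hsub : ∀ B ⊆ U, outDeg s t X B ≤ outDeg s t (X \ J) B := fun B hB => by
    rw [outDeg, outDeg, ← Finset.sum_filter_add_sum_filter_not X (· ∈ J)]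
    rw [Finset.sum_eq_zero fun e he => if_neg fun h' => hJU e (Finset.mem_filter.1 he).2 (hB h'.1),
      zero_add, Finset.sdiff_eq_filter]
  by_cases htight : ∃ B, IsRootedDicut s t r B ∧ outDeg s t (X \ J) B ≤ N ∧ (B ∩ U).Nonempty
  · obtain ⟨B, ⟨hB, hBN, hBU⟩, hmin⟩ := WellFounded.has_min (measure Finset.card).wf _ htight
    have h1 := hX _ (hB.inter hU hBU)
    obtain ⟨e, he, h2, h3⟩ := exists_mem_of_outDeg_lt (s := s) (t := t) (F := X \ J) (B := B)
      (C := B ∩ U) (by linarith [hsub (B ∩ U) Finset.inter_subset_right])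
    simp only [Finset.mem_inter, not_and, not_not] at h2 h3
    have htB := h3 h2.1.1
    refine ⟨e, he, h2.1.2, h2.2 htB, fun C hC hCN hCe => ?_⟩
    have hne : (B ∩ C).Nonempty := ⟨s e, by simp [h2.1.1, hCe.1]⟩
    have h4 := outDeg_inter_add_union_le s t (X \ J) B C
    have h5 := hJ _ (hB.union hC)
    refine hmin (B ∩ C) ⟨hB.inter hC hne, by linarith, ⟨s e, by simp [h2.1, hCe.1]⟩⟩ ?_
    exact Finset.card_lt_card (Finset.ssubset_iff_subset_ne.2 ⟨Finset.inter_subset_left,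
      fun h' => hCe.2 (Finset.mem_inter.1 (h'.symm ▸ htB)).2⟩)
  · push Not at htight
    obtain ⟨e, he, h1, h2⟩ := outDeg_pos (by linarith [hX U hU, hsub U subset_rfl] :
      0 < outDeg s t (X \ J) U)
    refine ⟨e, he, h1, h2, fun B hB hBN hBe => ?_⟩
    have := htight B hB hBN
    exact Finset.notMem_empty (s e) (this ▸ Finset.mem_inter.2 ⟨hBe.1, h1⟩)

theorem exists_cover_of_isRootedDicut {s t : E → W} {r : W} {X : Finset E} {N : ℤ} (hN : 0 ≤ N)
    (hX : ∀ B, IsRootedDicut s t r B → N + 1 ≤ outDeg s t X B) (n : ℕ) {U : Finset W}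
    (hn : U.card = n) (hU : U = ∅ ∨ IsRootedDicut s t r U) {J : Finset E} (hJX : J ⊆ X)
    (hJU : ∀ e ∈ J, s e ∉ U) (hcov : ∀ B, IsRootedDicut s t r B → ¬ B ⊆ U →
      ∃ e ∈ J, s e ∈ B ∧ t e ∉ B)
    (hJ : ∀ B, IsRootedDicut s t r B → N ≤ outDeg s t (X \ J) B) :
    ∃ J' ⊆ X, (∀ B, IsRootedDicut s t r B → ∃ e ∈ J', s e ∈ B ∧ t e ∉ B) ∧
      ∀ B, IsRootedDicut s t r B → N ≤ outDeg s t (X \ J') B := by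
  induction n using Nat.strong_induction_on generalizing U J with
  | _ n ih =>
    rcases hU with rfl | hU
    · exact ⟨J, hJX, fun B hB => hcov B hB fun h' => hB.1.ne_empty (Finset.subset_empty.1 h'), hJ⟩
    obtain ⟨e, he, hs, ht, hloose⟩ := exists_arc_of_isRootedDicut hN hX hU hJU hJ
    obtain ⟨M, hMU, hM, hgreatest⟩ := exists_greatest_isRootedDicut s t r (U.erase (s e))
    have hMU' : M ⊆ U := hMU.trans (Finset.erase_subset _ _)
    have hsM : s e ∉ M := fun h' => Finset.notMem_erase _ _ (hMU h')
    refine ih M.card ?_ rfl hM (J := insert e J)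
      (Finset.insert_subset (Finset.mem_sdiff.1 he).1 hJX) ?_ ?_ ?_
    · rw [← hn]
      exact Finset.card_lt_card (Finset.ssubset_iff_subset_ne.2 ⟨hMU', fun h' => hsM (h' ▸ hs)⟩)
    · intro d hd
      rcases Finset.mem_insert.1 hd with rfl | hd
      · exact hsM
      · exact fun h' => hJU d hd (hMU' h')
    · intro B hB hBM
      by_cases hBU : B ⊆ U
      · refine ⟨e, by simp, ?_, fun h' => ht (hBU h')⟩
        by_contra hsB
        exact hBM (hgreatest B (fun x hx => Finset.mem_erase.2
          ⟨ne_of_mem_of_not_mem hx hsB, hBU hx⟩) hB)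
      · obtain ⟨d, hd, h⟩ := hcov B hB hBU
        exact ⟨d, Finset.mem_insert_of_mem hd, h⟩
    · intro B hB
      have h1 : X \ J = insert e (X \ insert e J) := by
        rw [Finset.sdiff_insert, Finset.insert_erase he]
      have h2 := outDeg_insert s t (F := X \ insert e J) (e := e) (by simp) B
      rw [← h1] at h2
      have h3 := hJ B hB
      by_cases h4 : s e ∈ B ∧ t e ∉ B
      · have h5 : N < outDeg s t (X \ J) B := by
          by_contra! h5
          exact hloose B hB h5 h4
        rw [if_pos h4] at h2
        linarith
      · rw [if_neg h4] at h2
        linarith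

theorem exists_packing_of_isRootedDicut {s t : E → W} {r : W} (U : Finset W)
    (hU : ∀ B, IsRootedDicut s t r B → B ⊆ U) (N : ℕ) {X : Finset E}
    (hX : ∀ B, IsRootedDicut s t r B → N ≤ outDeg s t X B) :
    ∃ J : Fin N → Finset E, (∀ i, J i ⊆ X) ∧ (∀ i j, i ≠ j → Disjoint (J i) (J j)) ∧
      ∀ i B, IsRootedDicut s t r B → ∃ e ∈ J i, s e ∈ B ∧ t e ∉ B := by
  induction N generalizing X with
  | zero => exact ⟨fun _ => ∅, by simp, by simp, fun i => i.elim0⟩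
  | succ N ih =>
    obtain ⟨M, -, hM, hgreatest⟩ := exists_greatest_isRootedDicut s t r U
    obtain ⟨J₀, hJ₀, hcov, hrest⟩ := exists_cover_of_isRootedDicut (N := N) (by positivity)
      (fun B hB => by simpa using hX B hB) M.card rfl hM (J := ∅) (by simp) (by simp)
      (fun B hB h' => absurd (hgreatest B (hU B hB) hB) h')
      (fun B hB => by
        have := hX B hB
        push_cast at this
        simp only [Finset.sdiff_empty]
        linarith)
    obtain ⟨J, hJ, hdisj, hJcov⟩ := ih hrest
    have h0 : ∀ i, Disjoint J₀ (J i) := fun i =>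
      Finset.disjoint_of_subset_right (hJ i) Finset.disjoint_sdiff
    refine ⟨Fin.cons J₀ J, ?_, ?_, ?_⟩
    · intro i
      cases i using Fin.cases with
      | zero => exact hJ₀
      | succ i => exact (hJ i).trans Finset.sdiff_subset
    · intro i j hij
      cases i using Fin.cases with
      | zero =>
        cases j using Fin.cases with
        | zero => exact absurd rfl hij
        | succ j => exact h0 j
      | succ i =>
        cases j using Fin.cases with
        | zero => exact (h0 i).symm
        | succ j => exact hdisj i j fun h' => hij (congrArg _ h')
    · intro i
      cases i using Fin.cases with
      | zero => exact hcov
      | succ i => exact hJcov i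

end

/-- Every digraph with minimum dicut size `τ` whose underlying undirected graph is
`6p`-edge-connected contains `⌊τp/(2p+1)⌋` pairwise arc-disjoint dijoins. -/
theorem pack_dijoins_high_connectivity (src tgt : A → V) (τ p : ℕ) (hp : 0 < p)
    (hmin : ∀ U : Finset V, IsDicut src tgt U → τ ≤ (outArcs src tgt U).card)
    (hconn : ∀ U : Finset V, U.Nonempty → U ≠ univ → 6 * p ≤ (cutEdges src tgt U).card) :
    ∃ J : Fin (τ * p / (2 * p + 1)) → Finset A,
      (∀ i j, i ≠ j → Disjoint (J i) (J j)) ∧ ∀ i, IsDijoin src tgt (J i) := by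
  rcases isEmpty_or_nonempty V with hV | ⟨⟨r⟩⟩
  · exact ⟨fun _ => ∅, fun _ _ _ => disjoint_empty_left _,
      fun _ U hU => (IsEmpty.false hU.1.choose).elim⟩
  have hout (U : Finset V) : outDeg src tgt univ U = (outArcs src tgt U).card := by
    simp [outDeg, outArcs]
  have hin (U : Finset V) : outDeg tgt src univ U = (inArcs src tgt U).card := by
    simp [outDeg, inArcs]
  obtain ⟨Z, hZ⟩ := exists_balanced_arcs src tgt hp fun B h0 h1 => by
    rw [hout, hin]
    exact_mod_cast (hconn B h0 h1).trans (card_union_le _ _)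
  set N := τ * p / (2 * p + 1)
  have hNle : (N : ℤ) * (2 * p + 1) ≤ τ * p := by
    exact_mod_cast Nat.div_mul_le_self (τ * p) (2 * p + 1)
  have hbound (U : Finset V) (hU : IsDicut src tgt U) :
      (N : ℤ) ≤ outDeg src tgt Z U ∧ (N : ℤ) ≤ outDeg src tgt Zᶜ U := by
    have hτ : (τ : ℤ) ≤ outDeg src tgt univ U := by
      rw [hout]
      exact_mod_cast hmin U hU
    have hadd : outDeg src tgt Z U + outDeg src tgt Zᶜ U = outDeg src tgt univ U :=
      sum_add_sum_compl _ _
    obtain ⟨h1, h2⟩ := hZ U (by simp [hin, hU.2.2])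
    have hp0 : (0 : ℤ) < 2 * p + 1 := by positivity
    have hτp : (τ : ℤ) * p ≤ p * outDeg src tgt univ U := by
      rw [mul_comm]
      gcongr
    rw [← eq_sub_iff_add_eq'] at hadd
    rw [hadd]
    constructor <;> refine le_of_mul_le_mul_left ?_ hp0 <;> linarith
  obtain ⟨J, hJZ, hJ, hJcut⟩ := exists_packing_of_isRootedDicut (s := src) (t := tgt) (r := r)
    univ (fun B _ => subset_univ B) N (X := Z) fun B hB =>
      (hbound B ⟨hB.1, fun h => hB.2.1 (h ▸ mem_univ r),
        filter_eq_empty_iff.2 fun e _ he => he.2 (hB.2.2 e he.1)⟩).1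
  obtain ⟨K, hKZ, hK, hKcut⟩ := exists_packing_of_isRootedDicut (s := tgt) (t := src) (r := r)
    univ (fun B _ => subset_univ B) N (X := Zᶜ) fun B hB => by
      have h := (hbound Bᶜ ⟨⟨r, mem_compl.2 hB.2.1⟩, fun h => by simp_all [hB.1.ne_empty],
        filter_eq_empty_iff.2 fun e _ he =>
          mem_compl.1 he.1 (hB.2.2 e (by simpa using he.2))⟩).2
      simpa [outDeg, and_comm] using h
  refine ⟨fun i => J i ∪ K i, fun i j hij => ?_, fun i U hU => ?_⟩
  · have hZc : Disjoint Z Zᶜ := disjoint_compl_right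
    simp only [disjoint_union_left, disjoint_union_right]
    exact ⟨⟨hJ i j hij, hZc.symm.mono (hKZ i) (hJZ j)⟩,
      ⟨hZc.mono (hJZ i) (hKZ j), hK i j hij⟩⟩
  · have hno (e : A) (he : tgt e ∈ U) : src e ∈ U := by
      by_contra h
      exact filter_eq_empty_iff.1 hU.2.2 (mem_univ e) ⟨he, h⟩
    by_cases hr : r ∈ U
    · obtain ⟨e, heK, h1, h2⟩ := hKcut i Uᶜ ⟨nonempty_iff_ne_empty.2 (by simpa using hU.2.1),
        by simpa using hr, fun e he => mem_compl.2 fun h => mem_compl.1 he (hno e h)⟩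
      exact ⟨e, by simp_all [outArcs]⟩
    · obtain ⟨e, heJ, h1, h2⟩ := hJcut i U ⟨hU.1, hr, hno⟩
      exact ⟨e, by simp_all [outArcs]⟩
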